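/- arXiv:math-ph/9911009 — 3 statements merged into one kernel-verified Lean document; each statement's English description precedes it below -/
import Mathlib

section
/- Let ν ≥ 1 and let h(θ) = Σ_{j=1}^ν h_j(θ_j), where each h_j : ℝ/2πℤ → ℝ is of class C^{3ν+3}. Let H₀₊ be the associated bounded self-adjoint operator on ℓ²(ℕ × ℤ^ν; ℂ). Then the spectrum of H₀₊ contains the closed interval [E₋ − 2, E₊ + 2], where E₊ = Σ_{j=1}^ν sup_θ h_j(θ) and E₋ = Σ_{j=1}^ν inf_θ h_j(θ). -/
open MeasureTheory Complex Real

noncomputable section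

/-- The Fourier coefficient `ĥ(k) = ∫_{T^ν} e^{i k·θ} h(θ) dσ(θ)` of a function on the
`ν`-dimensional torus `T^ν = (ℝ/2πℤ)^ν`, realized via `(2π)`-periodic functions on `ℝ^ν`
and the normalized measure `dσ = ∏ dθ_j/(2π)` on the fundamental box `(0, 2π]^ν`. -/
def torusFourierCoeff (ν : ℕ) (h : (Fin ν → ℝ) → ℂ) (k : Fin ν → ℤ) : ℂ :=
  ((1 / (2 * π)) ^ ν : ℝ) •
    ∫ θ in Set.univ.pi fun _ : Fin ν => Set.Ioc (0 : ℝ) (2 * π),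
      Complex.exp (Complex.I * ((∑ j, (k j : ℝ) * θ j : ℝ) : ℂ)) * h θ

/-- The Fourier coefficient `(2π)⁻¹ ∫ e^{ikθ} f(θ) dθ` over one period. -/
def circleCoeff (f : ℝ → ℂ) (k : ℤ) : ℂ :=
  ((1 / (2 * π) : ℝ) : ℂ) * ∫ θ in Set.Ioc (0 : ℝ) (2 * π), Complex.exp (Complex.I * (k * θ)) * f θ

theorem fourier_neg_two_pi (k : ℤ) (x : ℝ) :
    fourier (-k) (x : AddCircle (2 * π)) = Complex.exp (Complex.I * ((-k : ℤ) * x)) := by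
  rw [fourier_coe_apply]
  congr 1
  have : (π : ℂ) ≠ 0 := by exact_mod_cast Real.pi_ne_zero
  push_cast
  field_simp

theorem circleCoeff_eq_fourierCoeffOn (f : ℝ → ℂ) (k : ℤ) :
    circleCoeff f k = fourierCoeffOn Real.two_pi_pos f (-k) := by
  rw [fourierCoeffOn_eq_integral, intervalIntegral.integral_of_le Real.two_pi_pos.le, circleCoeff,
    sub_zero, Complex.real_smul]
  congr 2
  ext x
  rw [fourier_neg_two_pi, smul_eq_mul, neg_neg]

theorem circleCoeff_const_one (k : ℤ) : circleCoeff (fun _ => 1) k = if k = 0 then 1 else 0 := by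
  have hpi : (π : ℂ) ≠ 0 := by exact_mod_cast Real.pi_ne_zero
  unfold circleCoeff
  rw [← intervalIntegral.integral_of_le Real.two_pi_pos.le]
  split_ifs with hk
  · subst hk
    simp
    field_simp
  · have hk' : (k : ℂ) ≠ 0 := by exact_mod_cast hk
    have : ∀ x : ℝ, Complex.exp (Complex.I * (k * x)) * 1 = Complex.exp ((Complex.I * k) * x) := by
      intro x; rw [mul_one, mul_assoc]
    simp_rw [this]
    rw [integral_exp_mul_complex (mul_ne_zero Complex.I_ne_zero hk')]
    have : Complex.exp (Complex.I * k * ((2 * π : ℝ) : ℂ)) = 1 := by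
      rw [← Complex.exp_int_mul_two_pi_mul_I k]
      congr 1; push_cast; ring
    rw [this]; simp

theorem hasSum_circleCoeff {f : ℝ → ℂ} (hf : Continuous f) (hper : Function.Periodic f (2 * π))
    (hsum : Summable (circleCoeff f)) (θ : ℝ) :
    HasSum (fun k : ℤ => circleCoeff f k * Complex.exp (-(Complex.I * (k * θ)))) (f θ) := by
  have : Fact (0 < 2 * π) := ⟨Real.two_pi_pos⟩
  let F : C(AddCircle (2 * π), ℂ) :=
    ⟨hper.lift, continuous_coinduced_dom.mpr hf⟩
  have hF : ∀ k, fourierCoeff F k = circleCoeff f (-k) := by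
    intro k
    rw [fourierCoeff_eq_intervalIntegral _ k 0, zero_add,
      intervalIntegral.integral_of_le Real.two_pi_pos.le, circleCoeff, Complex.real_smul]
    congr 2
    ext x
    rw [fourier_neg_two_pi, smul_eq_mul]
    congr 1
  have hs : Summable (fourierCoeff F) := by
    rw [funext hF]
    exact (Equiv.neg ℤ).summable_iff.mpr hsum
  have := has_pointwise_sum_fourier_series_of_summable hs (θ : AddCircle (2 * π))
  rw [← (Equiv.neg ℤ).hasSum_iff] at this
  convert! this using 1
  ext k
  simp only [Function.comp, Equiv.neg_apply, hF, neg_neg, smul_eq_mul]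
  rw [fourier_neg_two_pi]
  congr 2; push_cast; ring

theorem exists_bound_circleCoeff (m : ℕ) : ∀ {f : ℝ → ℂ}, ContDiff ℝ m f →
    Function.Periodic f (2 * π) → ∃ C : ℝ, ∀ k : ℤ, |(k : ℝ)| ^ m * ‖circleCoeff f k‖ ≤ C := by
  induction m with
  | zero =>
    intro f hf _
    refine ⟨1 / (2 * π) * ∫ θ in Set.Ioc (0 : ℝ) (2 * π), ‖f θ‖, fun k => ?_⟩
    have hpi := Real.two_pi_pos
    rw [pow_zero, one_mul, circleCoeff, norm_mul, Complex.norm_real, Real.norm_of_nonneg (by positivity)]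
    gcongr
    refine (norm_integral_le_integral_norm _).trans_eq ?_
    congr 1
    ext θ
    rw [norm_mul]
    have : Complex.I * (k * θ) = ((k * θ : ℝ) : ℂ) * Complex.I := by push_cast; ring
    rw [this, Complex.norm_exp_ofReal_mul_I, one_mul]
  | succ m ih =>
    intro f hf hper
    have hf' : ContDiff ℝ m (deriv f) := by
      have := (contDiff_succ_iff_deriv (n := (m : WithTop ℕ∞))).1 (by exact_mod_cast hf)
      exact this.2.2
    have hd : Differentiable ℝ f := hf.differentiable (by simp)
    have hper' : Function.Periodic (deriv f) (2 * π) := by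
      intro x
      rw [← deriv_comp_add_const]
      congr 1
      exact funext hper
    obtain ⟨C, hC⟩ := ih hf' hper'
    refine ⟨max C 0, fun k => ?_⟩
    rcases eq_or_ne k 0 with rfl | hk
    · simp
    have h1 := fourierCoeffOn_of_hasDerivAt Real.two_pi_pos (f := f) (f' := deriv f) (n := -k)
      (neg_ne_zero.mpr hk) (fun x _ => (hd x).hasDerivAt)
      (hf'.continuous.intervalIntegrable _ _)
    rw [← circleCoeff_eq_fourierCoeffOn, ← circleCoeff_eq_fourierCoeffOn] at h1
    have h0 : f (2 * π) = f 0 := by simpa using hper 0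
    have hpi : (π : ℂ) ≠ 0 := by exact_mod_cast Real.pi_ne_zero
    have hk' : (k : ℂ) ≠ 0 := by exact_mod_cast hk
    have h2 : (k : ℂ) * circleCoeff f k = Complex.I * circleCoeff (deriv f) k := by
      rw [h1, h0]
      push_cast
      field_simp
      rw [Complex.I_sq]
      ring
    have h3 : |(k : ℝ)| * ‖circleCoeff f k‖ = ‖circleCoeff (deriv f) k‖ := by
      have := congrArg norm h2
      simpa [norm_mul] using this
    rw [pow_succ, mul_assoc, h3]
    exact (hC k).trans (le_max_left _ _)

theorem summable_abs_mul_circleCoeff {f : ℝ → ℂ} (hf : ContDiff ℝ 3 f)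
    (hper : Function.Periodic f (2 * π)) :
    Summable (fun k : ℤ => |(k : ℝ)| * ‖circleCoeff f k‖) := by
  obtain ⟨C, hC⟩ := exists_bound_circleCoeff 3 (by exact_mod_cast hf) hper
  refine Summable.of_nonneg_of_le (fun k => by positivity) (fun k => ?_)
    ((Real.summable_one_div_int_pow.mpr one_lt_two).mul_left C)
  rcases eq_or_ne k 0 with rfl | hk
  · simp
  have hk' : 0 < |(k : ℝ)| := abs_pos.mpr (by exact_mod_cast hk)
  rw [mul_one_div, ← sq_abs, le_div_iff₀ (by positivity)]
  calc _ = |(k : ℝ)| ^ 3 * ‖circleCoeff f k‖ := by ring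
    _ ≤ C := hC k

theorem summable_circleCoeff {f : ℝ → ℂ} (hf : ContDiff ℝ 3 f)
    (hper : Function.Periodic f (2 * π)) : Summable (circleCoeff f) := by
  refine Summable.of_norm_bounded_eventually (summable_abs_mul_circleCoeff hf hper) ?_
  refine (Set.finite_singleton (0 : ℤ)).subset fun k hk => ?_
  by_contra h0
  refine hk (le_mul_of_one_le_left (norm_nonneg _) ?_)
  exact_mod_cast Int.one_le_abs h0

theorem torusFourierCoeff_sum {ν : ℕ} {f : Fin ν → ℝ → ℝ} (hf : ∀ j, Continuous (f j))
    (k : Fin ν → ℤ) :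
    torusFourierCoeff ν (fun θ => ((∑ j, f j (θ j) : ℝ) : ℂ)) k =
      ∑ j, if ∀ i, i ≠ j → k i = 0 then circleCoeff (fun x => f j x) (k j) else 0 := by
  let g : Fin ν → Fin ν → ℝ → ℂ := fun j i => if i = j then fun x => f j x else fun _ => 1
  have hg : ∀ j i, Continuous (g j i) := by
    intro j i
    have := hf j
    by_cases hij : i = j
    · simp only [g, if_pos hij]; fun_prop
    · simp only [g, if_neg hij]; fun_prop
  have hgprod : ∀ j (θ : Fin ν → ℝ), ∏ i, g j i (θ i) = f j (θ j) := by
    intro j θ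
    rw [Finset.prod_eq_single j]
    · simp [g]
    · intro i _ hij; simp [g, hij]
    · simp
  have hexp : ∀ θ : Fin ν → ℝ, Complex.exp (Complex.I * ((∑ j, (k j : ℝ) * θ j : ℝ) : ℂ)) *
      ((∑ j, f j (θ j) : ℝ) : ℂ) =
        ∑ j, ∏ i, (Complex.exp (Complex.I * (k i * θ i)) * g j i (θ i)) := by
    intro θ
    simp_rw [Finset.prod_mul_distrib, hgprod, ← Finset.mul_sum]
    push_cast
    rw [← Complex.exp_sum, ← Finset.mul_sum]
  unfold torusFourierCoeff
  simp_rw [hexp]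
  rw [volume_pi, Measure.restrict_pi_pi, integral_finsetSum]
  · rw [Finset.smul_sum]
    refine Finset.sum_congr rfl fun j _ => ?_
    rw [integral_fintype_prod_eq_prod (f := fun i (x : ℝ) =>
      Complex.exp (Complex.I * (k i * x)) * g j i x)]
    have : ∏ i, circleCoeff (g j i) (k i) =
        if ∀ i, i ≠ j → k i = 0 then circleCoeff (fun x => f j x) (k j) else 0 := by
      split_ifs with hk
      · rw [Finset.prod_eq_single j]
        · simp [g]
        · intro i _ hij; simp [g, hij, circleCoeff_const_one, hk i hij]
        · simp
      · push Not at hk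
        obtain ⟨i, hij, hi⟩ := hk
        refine Finset.prod_eq_zero (Finset.mem_univ i) ?_
        simp [g, hij, circleCoeff_const_one, hi]
    rw [← this]
    simp only [circleCoeff, Finset.prod_mul_distrib, Finset.prod_const, Finset.card_univ,
      Fintype.card_fin, Complex.real_smul]
    push_cast
    rfl
  · intro j _
    refine Integrable.fintype_prod (f := fun i (x : ℝ) =>
      Complex.exp (Complex.I * (k i * x)) * g j i x) fun i => ?_
    have := hg j i
    exact (Continuous.integrableOn_Icc (by fun_prop)).mono_set Set.Ioc_subset_Icc_self

theorem hasSum_torusFourierCoeff_mul {ν : ℕ} {f : Fin ν → ℝ → ℝ} (hf : ∀ j, Continuous (f j))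
    (v : (Fin ν → ℤ) → ℂ) (n : Fin ν → ℤ)
    (hs : ∀ j, Summable fun k : ℤ => circleCoeff (fun x => f j x) k * v (n - Pi.single j k)) :
    HasSum (fun m => torusFourierCoeff ν (fun θ => ((∑ j, f j (θ j) : ℝ) : ℂ)) (n - m) * v m)
      (∑ j, ∑' k : ℤ, circleCoeff (fun x => f j x) k * v (n - Pi.single j k)) := by
  simp_rw [torusFourierCoeff_sum hf, Finset.sum_mul]
  refine hasSum_sum fun j _ => ?_
  have hinj : Function.Injective fun k : ℤ => n - Pi.single j k := by
    intro k l hkl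
    exact Pi.single_injective j (sub_right_injective hkl)
  refine (hinj.hasSum_iff fun m hm => ?_).1 ?_
  · rw [if_neg, zero_mul]
    intro hz
    refine hm ⟨(n - m) j, ?_⟩
    ext i
    by_cases hij : i = j
    · subst hij; simp
    · have := hz i hij
      simp [hij] at this ⊢
      omega
  · convert! (hs j).hasSum using 2 with k
    simp only [Function.comp, sub_sub_cancel, Pi.single_eq_same]
    rw [if_pos]
    intro i hij
    simp [hij]

theorem summable_prod_pi {ν : ℕ} {α : Type*} {f : Fin ν → α → ℝ} (hf : ∀ i a, 0 ≤ f i a)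
    (hs : ∀ i, Summable (f i)) : Summable fun n : Fin ν → α => ∏ i, f i (n i) := by
  induction ν with
  | zero => exact Summable.of_finite
  | succ ν ih =>
    rw [← (Fin.consEquiv fun _ : Fin (ν + 1) => α).summable_iff]
    have := (hs 0).mul_of_nonneg (ih (f := fun i => f i.succ) (fun i => hf _) fun i => hs _)
      (hf 0) (fun n => Finset.prod_nonneg fun i _ => hf _ _)
    refine this.congr fun p => ?_
    simp [Fin.prod_univ_succ, Fin.consEquiv]

/-- The slowly decaying amplitude `(1 + ε|x|)⁻¹`. -/
def slowWeight (ε x : ℝ) : ℝ := (1 + ε * |x|)⁻¹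

theorem slowWeight_pos {ε : ℝ} (hε : 0 < ε) (x : ℝ) : 0 < slowWeight ε x := by
  unfold slowWeight; positivity

theorem abs_slowWeight_sub_le {ε : ℝ} (hε : 0 < ε) (x y : ℝ) :
    |slowWeight ε (x - y) - slowWeight ε x| ≤ ε * |y| * slowWeight ε x := by
  have h1 : 0 < 1 + ε * |x| := by positivity
  have h2 : 0 < 1 + ε * |x - y| := by positivity
  have h3 : slowWeight ε (x - y) - slowWeight ε x =
      ε * (|x| - |x - y|) * slowWeight ε x * slowWeight ε (x - y) := by
    unfold slowWeight; field_simp; ring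
  have h4 : |(|x| - |x - y|)| ≤ |y| := by
    simpa using abs_abs_sub_abs_le_abs_sub x (x - y)
  have h5 : slowWeight ε (x - y) ≤ 1 := inv_le_one_of_one_le₀ (by nlinarith [abs_nonneg (x - y)])
  have h6 := slowWeight_pos hε x
  have h7 := slowWeight_pos hε (x - y)
  rw [h3, abs_mul, abs_mul, abs_mul, abs_of_pos hε, abs_of_pos h6, abs_of_pos h7]
  calc _ ≤ ε * |(|x| - |x - y|)| * slowWeight ε x * 1 := by gcongr
    _ ≤ _ := by rw [mul_one]; gcongr

theorem summable_slowWeight_sq {ε : ℝ} (hε : 0 < ε) :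
    Summable fun m : ℤ => slowWeight ε m ^ 2 := by
  refine Summable.of_norm_bounded_eventually
    ((Real.summable_one_div_int_pow.mpr one_lt_two).mul_left (1 / ε ^ 2)) ?_
  refine (Set.finite_singleton (0 : ℤ)).subset fun k hk => ?_
  by_contra h0
  refine hk ?_
  have : 0 < |(k : ℝ)| := abs_pos.mpr (by exact_mod_cast h0)
  rw [Set.mem_ofPred_eq, Real.norm_of_nonneg (by positivity), ← sq_abs (k : ℝ), one_div_mul_one_div, ← mul_pow,
    slowWeight, inv_pow, one_div]
  gcongr
  linarith

/-- A plane wave of frequency `θ` with slowly decaying amplitude. -/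
def slowWave (ε θ : ℝ) (m : ℤ) : ℂ := Complex.exp (Complex.I * (m * θ)) * slowWeight ε m

theorem norm_slowWave {ε : ℝ} (hε : 0 < ε) (θ : ℝ) (m : ℤ) :
    ‖slowWave ε θ m‖ = slowWeight ε m := by
  have : Complex.I * (m * θ) = ((m * θ : ℝ) : ℂ) * Complex.I := by push_cast; ring
  rw [slowWave, norm_mul, this, Complex.norm_exp_ofReal_mul_I, one_mul, Complex.norm_real,
    Real.norm_of_nonneg (slowWeight_pos hε _).le]

theorem norm_slowWave_sub_le {ε : ℝ} (hε : 0 < ε) (θ : ℝ) (m k : ℤ) :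
    ‖slowWave ε θ (m - k) - Complex.exp (-(Complex.I * (k * θ))) * slowWave ε θ m‖ ≤
      ε * |(k : ℝ)| * ‖slowWave ε θ m‖ := by
  have h1 : slowWave ε θ (m - k) - Complex.exp (-(Complex.I * (k * θ))) * slowWave ε θ m =
      Complex.exp (((m - k) * θ : ℝ) * Complex.I) *
        ((slowWeight ε (m - k) - slowWeight ε m : ℝ) : ℂ) := by
    rw [slowWave, slowWave, ← mul_assoc (Complex.exp (-_)), ← Complex.exp_add]
    have e1 : Complex.I * (((m - k : ℤ) : ℂ) * θ) = ((m - k) * θ : ℝ) * Complex.I := by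
      push_cast; ring
    have e2 : -(Complex.I * (k * θ)) + Complex.I * (m * θ) = ((m - k) * θ : ℝ) * Complex.I := by
      push_cast; ring
    rw [e1, e2]; push_cast; ring
  rw [h1, norm_mul, Complex.norm_exp_ofReal_mul_I, one_mul, Complex.norm_real, norm_slowWave hε]
  exact abs_slowWeight_sub_le hε _ _

theorem norm_slowWave_add_sub_le {ε : ℝ} (hε : 0 < ε) (φ : ℝ) (m : ℤ) :
    ‖slowWave ε φ (m + 1) + slowWave ε φ (m - 1) - (2 * Real.cos φ : ℝ) * slowWave ε φ m‖ ≤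
      2 * ε * ‖slowWave ε φ m‖ := by
  have h1 := norm_slowWave_sub_le hε φ m 1
  have h2 := norm_slowWave_sub_le hε φ m (-1)
  have h3 : ((2 * Real.cos φ : ℝ) : ℂ) =
      Complex.exp (-(Complex.I * ((1 : ℤ) * φ))) + Complex.exp (-(Complex.I * ((-1 : ℤ) * φ))) := by
    push_cast
    rw [Complex.two_cos]
    rw [add_comm]
    congr 2 <;> ring
  rw [sub_neg_eq_add] at h2
  calc _ = ‖(slowWave ε φ (m - 1) - Complex.exp (-(Complex.I * ((1 : ℤ) * φ))) * slowWave ε φ m) +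
        (slowWave ε φ (m + 1) - Complex.exp (-(Complex.I * ((-1 : ℤ) * φ))) * slowWave ε φ m)‖ := by
        rw [h3]; congr 1; ring
    _ ≤ _ := (norm_add_le _ _).trans (add_le_add h1 h2)
    _ = _ := by norm_num; ring

theorem summable_norm_slowWave_sq {ε : ℝ} (hε : 0 < ε) (θ : ℝ) :
    Summable fun m : ℤ => ‖slowWave ε θ m‖ ^ 2 := by
  simp_rw [norm_slowWave hε]
  exact summable_slowWeight_sq hε

/-- The product of slowly decaying plane waves on `ℤ^ν`. -/
def slowWavePi {ν : ℕ} (ε : ℝ) (θ : Fin ν → ℝ) (n : Fin ν → ℤ) : ℂ := ∏ i, slowWave ε (θ i) (n i)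

theorem norm_slowWavePi_sub_single_le {ν : ℕ} {ε : ℝ} (hε : 0 < ε) (θ : Fin ν → ℝ)
    (n : Fin ν → ℤ) (j : Fin ν) (k : ℤ) :
    ‖slowWavePi ε θ (n - Pi.single j k) -
        Complex.exp (-(Complex.I * (k * θ j))) * slowWavePi ε θ n‖ ≤
      ε * |(k : ℝ)| * ‖slowWavePi ε θ n‖ := by
  unfold slowWavePi
  have hsplit : ∀ m : Fin ν → ℤ, ∏ i, slowWave ε (θ i) (m i) =
      slowWave ε (θ j) (m j) * ∏ i ∈ Finset.univ.erase j, slowWave ε (θ i) (m i) := fun m =>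
    (Finset.mul_prod_erase _ (fun i => slowWave ε (θ i) (m i)) (Finset.mem_univ j)).symm
  rw [hsplit n, hsplit]
  have : ∏ i ∈ Finset.univ.erase j, slowWave ε (θ i) ((n - (Pi.single j k : Fin ν → ℤ)) i) =
      ∏ i ∈ Finset.univ.erase j, slowWave ε (θ i) (n i) := by
    refine Finset.prod_congr rfl fun i hi => ?_
    simp [(Finset.mem_erase.mp hi).1]
  rw [this, ← mul_assoc (Complex.exp _), ← sub_mul, norm_mul, norm_mul, ← mul_assoc (ε * _)]
  refine mul_le_mul_of_nonneg_right ?_ (norm_nonneg _)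
  simpa using norm_slowWave_sub_le hε (θ j) (n j) k

theorem summable_norm_slowWavePi_sq {ν : ℕ} {ε : ℝ} (hε : 0 < ε) (θ : Fin ν → ℝ) :
    Summable fun n : Fin ν → ℤ => ‖slowWavePi ε θ n‖ ^ 2 := by
  simp_rw [slowWavePi, norm_prod, ← Finset.prod_pow]
  exact summable_prod_pi (f := fun i m => ‖slowWave ε (θ i) m‖ ^ 2) (fun _ _ => by positivity)
    fun i => summable_norm_slowWave_sq hε (θ i)

theorem slowWavePi_convolution {ν : ℕ} {ε : ℝ} (hε : 0 < ε) (θ : Fin ν → ℝ) {f : ℝ → ℂ}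
    (hf : ContDiff ℝ 3 f) (hper : Function.Periodic f (2 * π)) (n : Fin ν → ℤ) (j : Fin ν) :
    Summable (fun k : ℤ => circleCoeff f k * slowWavePi ε θ (n - Pi.single j k)) ∧
    ‖(∑' k : ℤ, circleCoeff f k * slowWavePi ε θ (n - Pi.single j k)) -
        f (θ j) * slowWavePi ε θ n‖ ≤
      ε * (∑' k : ℤ, |(k : ℝ)| * ‖circleCoeff f k‖) * ‖slowWavePi ε θ n‖ := by
  have h1 := (hasSum_circleCoeff hf.continuous hper (summable_circleCoeff hf hper) (θ j)).mul_right
    (slowWavePi ε θ n)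
  have hM := ((summable_abs_mul_circleCoeff hf hper).mul_left ε).mul_right ‖slowWavePi ε θ n‖
  have hle : ∀ k : ℤ, ‖circleCoeff f k * slowWavePi ε θ (n - Pi.single j k) -
      circleCoeff f k * Complex.exp (-(Complex.I * (k * θ j))) * slowWavePi ε θ n‖ ≤
      ε * (|(k : ℝ)| * ‖circleCoeff f k‖) * ‖slowWavePi ε θ n‖ := by
    intro k
    rw [mul_assoc, ← mul_sub, norm_mul]
    refine (mul_le_mul_of_nonneg_left (norm_slowWavePi_sub_single_le hε θ n j k)
      (norm_nonneg _)).trans_eq (by ring)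
  have hd := Summable.of_norm_bounded hM hle
  have hs : Summable (fun k : ℤ => circleCoeff f k * slowWavePi ε θ (n - Pi.single j k)) :=
    (hd.add h1.summable).congr fun k => by ring
  refine ⟨hs, ?_⟩
  rw [← h1.tsum_eq, ← hs.tsum_sub h1.summable, ← tsum_mul_left, ← tsum_mul_right]
  exact tsum_of_norm_bounded hM.hasSum hle

theorem mem_spectrum_of_approximate_eigenvector {E : Type*} [NormedAddCommGroup E]
    [NormedSpace ℂ E] (T : E →L[ℂ] E) (z : ℂ)
    (h : ∀ δ > 0, ∃ u, u ≠ 0 ∧ ‖T u - z • u‖ ≤ δ * ‖u‖) : z ∈ spectrum ℂ T := by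
  rw [spectrum.mem_iff]
  rintro ⟨S, hS⟩
  have hB : ∀ u : E, ‖u‖ ≤ ‖(↑S⁻¹ : E →L[ℂ] E)‖ * ‖T u - z • u‖ := by
    intro u
    have h1 : (↑S⁻¹ : E →L[ℂ] E) (z • u - T u) = u := by
      have := congrArg (fun A : E →L[ℂ] E => A u) S.inv_mul
      rw [hS] at this
      simpa [Algebra.algebraMap_eq_smul_one] using this
    calc ‖u‖ = ‖(↑S⁻¹ : E →L[ℂ] E) (z • u - T u)‖ := by rw [h1]
      _ ≤ _ := ContinuousLinearMap.le_opNorm _ _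
      _ = _ := by rw [norm_sub_rev]
  set b := ‖(↑S⁻¹ : E →L[ℂ] E)‖
  have hb : 0 ≤ b := norm_nonneg _
  obtain ⟨u, hu, hle⟩ := h (1 / (2 * (b + 1))) (by positivity)
  have hu' : 0 < ‖u‖ := norm_pos_iff.mpr hu
  have h2 : ‖u‖ ≤ b * (1 / (2 * (b + 1)) * ‖u‖) :=
    (hB u).trans (mul_le_mul_of_nonneg_left hle hb)
  have h3 : b * (1 / (2 * (b + 1)) * ‖u‖) < ‖u‖ := by
    rw [one_div, ← mul_assoc, ← div_eq_mul_inv]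
    refine mul_lt_of_lt_one_left hu' ?_
    rw [div_lt_one (by positivity)]
    linarith
  linarith

theorem lp_two_norm_sq {ι : Type*} (u : lp (fun _ : ι => ℂ) 2) : ‖u‖ ^ 2 = ∑' i, ‖u i‖ ^ 2 := by
  simpa using lp.norm_rpow_eq_tsum (p := 2) (by simp) u

theorem lp_two_summable {ι : Type*} (u : lp (fun _ : ι => ℂ) 2) : Summable fun i => ‖u i‖ ^ 2 := by
  simpa using (lp.memℓp u).summable (p := 2) (by simp)

theorem memℓp_two_of_summable {ι : Type*} {f : ι → ℂ} (hf : Summable fun i => ‖f i‖ ^ 2) :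
    Memℓp f 2 :=
  memℓp_gen (by simpa using hf)

theorem lp_two_norm_le_of_le_add_slice {α β : Type*} [DecidableEq α]
    (u f : lp (fun _ : α × β => ℂ) 2) (a₀ a₁ : α) {s t : ℝ} (hs : 0 ≤ s) (ht : 0 ≤ t)
    (h : ∀ p, ‖f p‖ ≤ s * ‖u p‖ + if p.1 = a₀ then t * ‖u (a₁, p.2)‖ else 0) :
    ‖f‖ ≤ (s + t) * ‖u‖ := by
  have hslice : Summable fun b => ‖u (a₁, b)‖ ^ 2 :=
    (lp_two_summable u).comp_injective (Prod.mk_right_injective a₁)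
  let g : α × β → ℂ := fun p => if p.1 = a₀ then u (a₁, p.2) else 0
  have hg : HasSum (fun p => ‖g p‖ ^ 2) (∑' b, ‖u (a₁, b)‖ ^ 2) := by
    refine ((Prod.mk_right_injective a₀).hasSum_iff fun p hp => ?_).1 ?_
    · have : p.1 ≠ a₀ := fun hpa => hp ⟨p.2, by rw [← hpa]⟩
      simp [g, this]
    · simpa [g, Function.comp_def] using hslice.hasSum
  let G : lp (fun _ : α × β => ℂ) 2 := ⟨g, memℓp_two_of_summable hg.summable⟩
  have hG : ‖G‖ ≤ ‖u‖ := by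
    rw [← sq_le_sq₀ (norm_nonneg _) (norm_nonneg _), lp_two_norm_sq, lp_two_norm_sq]
    refine hg.tsum_eq.trans_le ?_
    exact tsum_comp_le_tsum_of_inj (lp_two_summable u) (fun p => by positivity)
      (Prod.mk_right_injective a₁)
  calc ‖f‖ ≤ ‖s • lp.toNorm u + t • lp.toNorm G‖ := by
        refine lp.norm_mono (by simp) fun p => ?_
        refine (h p).trans ((le_of_eq ?_).trans (le_abs_self _))
        change _ = s * ‖u p‖ + t * ‖g p‖
        by_cases hp : p.1 = a₀ <;> simp [g, hp]
    _ ≤ s * ‖u‖ + t * ‖G‖ := by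
        refine (norm_add_le _ _).trans_eq ?_
        rw [norm_smul, norm_smul, lp.norm_toNorm, lp.norm_toNorm, Real.norm_of_nonneg hs,
          Real.norm_of_nonneg ht]
    _ ≤ _ := by rw [add_mul]; gcongr

theorem exists_symbol_eq {ν : ℕ} {h : Fin ν → ℝ → ℝ} (hc : ∀ j, Continuous (h j))
    (hper : ∀ j, Function.Periodic (h j) (2 * π)) {x : ℝ}
    (hx : x ∈ Set.Icc ((∑ j, ⨅ θ : ℝ, h j θ) - 2) ((∑ j, ⨆ θ : ℝ, h j θ) + 2)) :
    ∃ (θ : Fin ν → ℝ) (φ : ℝ), ∑ j, h j (θ j) + 2 * Real.cos φ = x := by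
  have hcpt : ∀ j, IsCompact (Set.range (h j)) := fun j => by
    rw [← (hper j).image_Icc Real.two_pi_pos 0]
    exact isCompact_Icc.image (hc j)
  have hmin : ∀ j, ∃ θ, h j θ = ⨅ θ : ℝ, h j θ := fun j =>
    (hcpt j).sInf_mem (Set.range_nonempty _)
  have hmax : ∀ j, ∃ θ, h j θ = ⨆ θ : ℝ, h j θ := fun j =>
    (hcpt j).sSup_mem (Set.range_nonempty _)
  choose a ha using hmin
  choose b hb using hmax
  let F : ℝ → ℝ := fun t => ∑ j, h j ((1 - t) * a j + t * b j) + 2 * Real.cos (π * (1 - t))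
  have hF : Continuous F := by fun_prop
  have h0 : F 0 = (∑ j, ⨅ θ : ℝ, h j θ) - 2 := by simp [F, ha]; ring
  have h1 : F 1 = (∑ j, ⨆ θ : ℝ, h j θ) + 2 := by simp [F, hb]
  rw [← h0, ← h1] at hx
  obtain ⟨t, -, ht⟩ := intermediate_value_Icc zero_le_one hF.continuousOn hx
  exact ⟨_, _, ht⟩

/-- The half-space trial function: a slowly decaying plane wave centred at depth `N`. -/
def trialWave {ν : ℕ} (ε : ℝ) (N : ℕ) (φ : ℝ) (θ : Fin ν → ℝ) (p : ℕ × (Fin ν → ℤ)) : ℂ :=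
  slowWave ε φ (p.1 - N) * slowWavePi ε θ p.2

theorem memℓp_trialWave {ν : ℕ} {ε : ℝ} (hε : 0 < ε) (N : ℕ) (φ : ℝ) (θ : Fin ν → ℝ) :
    Memℓp (trialWave ε N φ θ) 2 := by
  refine memℓp_two_of_summable ?_
  have h1 : Summable fun n : ℕ => ‖slowWave ε φ (n - N)‖ ^ 2 :=
    (summable_norm_slowWave_sq hε φ).comp_injective (i := fun n : ℕ => (n - N : ℤ))
      fun a b hab => by simpa using hab
  refine (h1.mul_of_nonneg (summable_norm_slowWavePi_sq hε θ) (fun _ => by positivity)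
    fun _ => by positivity).congr fun p => ?_
  rw [trialWave, norm_mul, mul_pow]

theorem norm_halfLine_trialWave_le {ν : ℕ} {ε : ℝ} (hε : 0 < ε) (N : ℕ) (φ : ℝ)
    (θ : Fin ν → ℝ) (n₀ : ℕ) (n : Fin ν → ℤ) :
    ‖(if n₀ = 0 then trialWave ε N φ θ (1, n)
        else trialWave ε N φ θ (n₀ + 1, n) + trialWave ε N φ θ (n₀ - 1, n)) -
      (2 * Real.cos φ : ℝ) * trialWave ε N φ θ (n₀, n)‖ ≤
      2 * ε * ‖trialWave ε N φ θ (n₀, n)‖ +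
        if n₀ = 0 then slowWeight ε (N + 1) * ‖trialWave ε N φ θ (N, n)‖ else 0 := by
  have key := norm_slowWave_add_sub_le hε φ (n₀ - N)
  have key' : ‖(slowWave ε φ (n₀ - N + 1) + slowWave ε φ (n₀ - N - 1) -
      (2 * Real.cos φ : ℝ) * slowWave ε φ (n₀ - N)) * slowWavePi ε θ n‖ ≤
      2 * ε * ‖trialWave ε N φ θ (n₀, n)‖ := by
    rw [norm_mul, trialWave, norm_mul, ← mul_assoc]
    gcongr
  split_ifs with h0
  · subst h0
    have e : trialWave ε N φ θ (1, n) - (2 * Real.cos φ : ℝ) * trialWave ε N φ θ (0, n) =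
        (slowWave ε φ ((0 : ℕ) - N + 1) + slowWave ε φ ((0 : ℕ) - N - 1) -
          (2 * Real.cos φ : ℝ) * slowWave ε φ ((0 : ℕ) - N)) * slowWavePi ε θ n -
        slowWave ε φ ((0 : ℕ) - N - 1) * slowWavePi ε θ n := by
      have : ((0 : ℕ) - N + 1 : ℤ) = (1 : ℕ) - N := by push_cast; ring
      rw [trialWave, trialWave, this]
      ring
    rw [e]
    refine (norm_sub_le _ _).trans (add_le_add key' (le_of_eq ?_))
    rw [norm_mul, norm_slowWave hε, trialWave, norm_mul, norm_slowWave hε]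
    have e1 : slowWeight ε (((0 : ℕ) - N - 1 : ℤ) : ℝ) = slowWeight ε (N + 1) := by
      unfold slowWeight
      rw [← abs_neg]
      congr 4
      push_cast; ring
    have e2 : slowWeight ε ((N - N : ℤ) : ℝ) = 1 := by simp [slowWeight]
    rw [e1, e2, one_mul]
  · rw [add_zero]
    convert! key' using 2
    have e1 : ((n₀ + 1 : ℕ) - N : ℤ) = n₀ - N + 1 := by push_cast; ring
    have e2 : ((n₀ - 1 : ℕ) - N : ℤ) = n₀ - N - 1 := by omega
    simp only [trialWave, e1, e2]
    ring

theorem norm_convolution_trialWave_le {ν : ℕ} {ε : ℝ} (hε : 0 < ε) (N : ℕ) (φ : ℝ)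
    (θ : Fin ν → ℝ) {h : Fin ν → ℝ → ℝ} (hper : ∀ j, Function.Periodic (h j) (2 * π))
    (hsmooth : ∀ j, ContDiff ℝ 3 (h j)) (n₀ : ℕ) (n : Fin ν → ℤ) :
    ‖(∑' m : Fin ν → ℤ, torusFourierCoeff ν (fun θ => ((∑ j, h j (θ j) : ℝ) : ℂ)) (n - m) *
        trialWave ε N φ θ (n₀, m)) - (∑ j, h j (θ j) : ℝ) * trialWave ε N φ θ (n₀, n)‖ ≤
      ε * (∑ j, ∑' k : ℤ, |(k : ℝ)| * ‖circleCoeff (fun x => h j x) k‖) *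
        ‖trialWave ε N φ θ (n₀, n)‖ := by
  have hC : ∀ j, ContDiff ℝ 3 fun x => (h j x : ℂ) := fun j =>
    Complex.ofRealCLM.contDiff.comp (hsmooth j)
  have hP : ∀ j, Function.Periodic (fun x => (h j x : ℂ)) (2 * π) := fun j x => by
    simp only [hper j x]
  have hconv := fun j => slowWavePi_convolution hε θ (hC j) (hP j) n j
  have hsum := hasSum_torusFourierCoeff_mul (fun j => (hsmooth j).continuous) (slowWavePi ε θ) n
    fun j => (hconv j).1
  have hsum' := hsum.mul_left (slowWave ε φ (n₀ - N))
  have e : ∀ m, slowWave ε φ (n₀ - N) *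
      (torusFourierCoeff ν (fun θ => ((∑ j, h j (θ j) : ℝ) : ℂ)) (n - m) * slowWavePi ε θ m) =
      torusFourierCoeff ν (fun θ => ((∑ j, h j (θ j) : ℝ) : ℂ)) (n - m) *
        trialWave ε N φ θ (n₀, m) := fun m => by rw [trialWave]; ring
  simp_rw [e] at hsum'
  rw [hsum'.tsum_eq, trialWave, norm_mul, Complex.ofReal_sum, mul_left_comm, ← mul_sub,
    Finset.sum_mul, ← Finset.sum_sub_distrib, norm_mul, mul_left_comm _ ‖slowWave _ _ _‖]
  gcongr
  rw [Finset.mul_sum, Finset.sum_mul]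
  exact (norm_sum_le _ _).trans (Finset.sum_le_sum fun j _ => (hconv j).2)

theorem exists_slowWeight_le {ε : ℝ} (hε : 0 < ε) : ∃ N : ℕ, slowWeight ε (N + 1) ≤ ε := by
  obtain ⟨N, hN⟩ := exists_nat_ge (1 / ε ^ 2)
  refine ⟨N, inv_le_of_inv_le₀ hε ?_⟩
  rw [abs_of_nonneg (by positivity)]
  have : ε⁻¹ = ε * (1 / ε ^ 2) := by field_simp
  rw [this]
  nlinarith

/-- For `ν ≥ 1` and a separable function `h(θ) = ∑_j h_j(θ_j)` on the torus
with each `h_j` of class `C^{3ν+3}`, the spectrum of the half-space operator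
`H₀₊ = Δ₊ + I ⊗ H₀` on `ℓ²(ℕ × ℤ^ν; ℂ)` contains the interval `[E₋ − 2, E₊ + 2]`,
where `E₊ = ∑_j sup h_j`, `E₋ = ∑_j inf h_j`.  Here
`(Hplus u)(n₀, n) = (Δ₊ u)(n₀, n) + ∑_m ĥ(n−m) u(n₀, m)` with
`(Δ₊u)(n₀,n) = u(n₀+1,n) + u(n₀−1,n)` for `n₀ ≥ 1` and `(Δ₊u)(0,n) = u(1,n)`. -/
theorem spectrum_of_halfspace_operator_contains_interval
    (ν : ℕ) (hν : 1 ≤ ν)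
    (h : Fin ν → ℝ → ℝ)
    (hper : ∀ j, Function.Periodic (h j) (2 * π))
    (hsmooth : ∀ j, ContDiff ℝ (3 * ν + 3 : ℕ) (h j))
    (Hplus : lp (fun _ : ℕ × (Fin ν → ℤ) => ℂ) 2 →L[ℂ] lp (fun _ : ℕ × (Fin ν → ℤ) => ℂ) 2)
    (hHplus : ∀ (u : lp (fun _ : ℕ × (Fin ν → ℤ) => ℂ) 2) (n₀ : ℕ) (n : Fin ν → ℤ),
      Hplus u (n₀, n) =
        (if n₀ = 0 then u (1, n) else u (n₀ + 1, n) + u (n₀ - 1, n)) +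
          ∑' m : Fin ν → ℤ,
            torusFourierCoeff ν (fun θ => ((∑ j, h j (θ j) : ℝ) : ℂ)) (n - m) * u (n₀, m)) :
    Complex.ofReal '' Set.Icc ((∑ j, ⨅ θ : ℝ, h j θ) - 2) ((∑ j, ⨆ θ : ℝ, h j θ) + 2)
      ⊆ spectrum ℂ Hplus := by
  rintro _ ⟨x, hx, rfl⟩
  have hC : ∀ j, ContDiff ℝ 3 (h j) := fun j => (hsmooth j).of_le (by
    exact_mod_cast (by omega : 3 ≤ 3 * ν + 3))
  obtain ⟨θ, φ, hsymb⟩ := exists_symbol_eq (fun j => (hC j).continuous) hper hx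
  refine mem_spectrum_of_approximate_eigenvector _ _ fun δ hδ => ?_
  set M := ∑ j, ∑' k : ℤ, |(k : ℝ)| * ‖circleCoeff (fun x => h j x) k‖
  have hM : 0 ≤ M := Finset.sum_nonneg fun j _ => tsum_nonneg fun k => by positivity
  obtain ⟨ε, hε, hεδ⟩ : ∃ ε > 0, (2 * ε + ε * M) + ε ≤ δ :=
    ⟨δ / (3 + M), by positivity, le_of_eq (by field_simp; ring)⟩
  obtain ⟨N, hN⟩ := exists_slowWeight_le hε
  let u : lp (fun _ : ℕ × (Fin ν → ℤ) => ℂ) 2 := ⟨trialWave ε N φ θ, memℓp_trialWave hε N φ θ⟩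
  have hu : ∀ p, u p = trialWave ε N φ θ p := fun _ => rfl
  refine ⟨u, fun h0 => ?_, ?_⟩
  · have h1 : trialWave ε N φ θ (N, 0) = 0 := by rw [← hu, h0]; rfl
    have h2 : ‖trialWave ε N φ θ (N, 0)‖ ≠ 0 := by
      rw [trialWave, slowWavePi, norm_mul, norm_prod, norm_slowWave hε]
      exact mul_ne_zero (slowWeight_pos hε _).ne' (Finset.prod_ne_zero_iff.mpr fun i _ => by
        rw [norm_slowWave hε]; exact (slowWeight_pos hε _).ne')
    exact h2 (by rw [h1, norm_zero])
  · refine (lp_two_norm_le_of_le_add_slice u _ 0 N (s := 2 * ε + ε * M) (t := ε) (by positivity)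
      hε.le fun p => ?_).trans (mul_le_mul_of_nonneg_right hεδ (norm_nonneg _))
    obtain ⟨n₀, n⟩ := p
    have e1 : (Hplus u - (x : ℂ) • u) (n₀, n) = Hplus u (n₀, n) - x * u (n₀, n) := rfl
    rw [e1, hHplus]
    simp only [hu]
    have k1 := norm_halfLine_trialWave_le hε N φ θ n₀ n
    have k2 := norm_convolution_trialWave_le hε N φ θ hper hC n₀ n
    have k3 : (if n₀ = 0 then slowWeight ε (N + 1) * ‖trialWave ε N φ θ (N, n)‖ else 0) ≤
        if n₀ = 0 then ε * ‖trialWave ε N φ θ (N, n)‖ else 0 := by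
      split_ifs
      · gcongr
      · rfl
    rw [← hsymb, Complex.ofReal_add, add_comm ((∑ j, h j (θ j) : ℝ) : ℂ), add_mul, add_sub_add_comm]
    refine (norm_add_le _ _).trans ((add_le_add k1 k2).trans ?_)
    rw [add_mul (2 * ε)]
    linarith
end
end

section
/- Let ν ≥ 1 and let h(θ) = Σ_{j=1}^ν h_j(θ_j) with each h_j : ℝ/2πℤ → ℝ of class C^{3ν+3}. Let φ : T^ν → ℂ be a smooth function and v > 0 a constant such that |h₁′(θ₁)| ≥ v for every θ = (θ₁,…,θ_ν) in the support of φ. Then there is a constant C such that for all s ≥ 1: Σ over n ∈ ℤ^ν with |n₁| ≤ v s / 4 of |∫_{T^ν} e^{−i(n·θ + s h(θ))} φ(θ) dσ(θ)|² ≤ C s^{−4}. -/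
open MeasureTheory Complex Real

noncomputable section

lemma integral_pi_Ioc_exp {d : ℕ} (k : Fin d → ℤ) :
    ∫ θ in Set.univ.pi fun _ : Fin d => Set.Ioc (0 : ℝ) (2 * π),
      Complex.exp (Complex.I * ((∑ j, (k j : ℝ) * θ j : ℝ) : ℂ)) =
        if k = 0 then ((2 * π) ^ d : ℂ) else 0 := by
  have one_dim (m : ℤ) : ∫ t in Set.Ioc (0 : ℝ) (2 * π), Complex.exp ((Complex.I * m) * (t : ℂ)) =
      if m = 0 then (2 * π : ℂ) else 0 := by
    rw [← intervalIntegral.integral_of_le Real.two_pi_pos.le]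
    split_ifs with hm
    · simp [hm]
    · have hc : Complex.I * (m : ℂ) ≠ 0 := mul_ne_zero Complex.I_ne_zero (by exact_mod_cast hm)
      rw [integral_exp_mul_complex hc]
      have : Complex.exp (Complex.I * (m : ℂ) * ((2 * π : ℝ) : ℂ)) = 1 := by
        rw [Complex.exp_eq_one_iff]
        exact ⟨m, by push_cast; ring⟩
      rw [this]
      simp
  have prod_form (θ : Fin d → ℝ) :
      Complex.exp (Complex.I * ((∑ j, (k j : ℝ) * θ j : ℝ) : ℂ)) =
        ∏ j, Complex.exp ((Complex.I * k j) * (θ j : ℂ)) := by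
    rw [← Complex.exp_sum]
    push_cast
    rw [Finset.mul_sum]
    simp only [mul_assoc]
  simp_rw [prod_form]
  rw [volume_pi, Measure.restrict_pi_pi,
    integral_fintype_prod_eq_prod (𝕜 := ℂ)
      (fun j (t : ℝ) => Complex.exp ((Complex.I * k j) * (t : ℂ)))]
  simp_rw [one_dim]
  split_ifs with hk
  · simp [hk]
  · obtain ⟨j, hj⟩ := Function.ne_iff.mp hk
    exact Finset.prod_eq_zero (Finset.mem_univ j) (if_neg hj)

lemma volume_real_pi_Ioc (d : ℕ) :
    volume.real (Set.univ.pi fun _ : Fin d => Set.Ioc (0 : ℝ) (2 * π)) = (2 * π) ^ d := by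
  simp [measureReal_def, Real.volume_pi_Ioc, ENNReal.toReal_ofReal Real.pi_pos.le]

/-- Bessel's inequality for the Fourier coefficients of a bounded function on the torus. -/
lemma sum_sq_norm_fourier_coeff_le {d : ℕ} {F : (Fin d → ℝ) → ℂ} (hF : Continuous F) {M : ℝ}
    (hM : ∀ θ ∈ Set.univ.pi fun _ : Fin d => Set.Ioc (0 : ℝ) (2 * π), ‖F θ‖ ≤ M)
    (S : Finset (Fin d → ℤ)) :
    ∑ n ∈ S, ‖((1 / (2 * π)) ^ d : ℝ) •
      ∫ θ in Set.univ.pi fun _ : Fin d => Set.Ioc (0 : ℝ) (2 * π),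
        Complex.exp (-Complex.I * ((∑ j, (n j : ℝ) * θ j : ℝ) : ℂ)) * F θ‖ ^ 2 ≤ M ^ 2 := by
  set box := Set.univ.pi fun _ : Fin d => Set.Ioc (0 : ℝ) (2 * π) with hbox
  have hboxm : MeasurableSet box := MeasurableSet.univ_pi fun _ => measurableSet_Ioc
  have hvol : volume box < ⊤ := by
    rw [hbox, Real.volume_pi_Ioc]
    exact ENNReal.prod_lt_top fun _ _ => ENNReal.ofReal_lt_top
  have hc0 : (0 : ℝ) ≤ (1 / (2 * π)) ^ d := by positivity
  set c : ENNReal := ENNReal.ofReal ((1 / (2 * π)) ^ d) with hc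
  have hcR : c.toReal = (1 / (2 * π)) ^ d := ENNReal.toReal_ofReal hc0
  set μ : Measure (Fin d → ℝ) := c • volume.restrict box with hμ
  have hfin : IsFiniteMeasure (volume.restrict box) := ⟨by simpa using hvol⟩
  have hfinμ : IsFiniteMeasure μ := by
    rw [hμ]; exact Measure.smul_finite _ ENNReal.ofReal_ne_top
  let e : (Fin d → ℤ) → (Fin d → ℝ) → ℂ := fun n θ =>
    Complex.exp (Complex.I * ((∑ j, (n j : ℝ) * θ j : ℝ) : ℂ))
  have he_cont (n) : Continuous (e n) := by fun_prop
  have he_norm (n θ) : ‖e n θ‖ = 1 := by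
    simp only [e]; rw [mul_comm]; exact Complex.norm_exp_ofReal_mul_I _
  have he_mem (n) : MemLp (e n) 2 μ :=
    MemLp.of_bound (he_cont n).aestronglyMeasurable 1 (.of_forall fun θ => (he_norm n θ).le)
  have hFb : ∀ᵐ θ ∂μ, ‖F θ‖ ≤ M :=
    Measure.ae_smul_measure ((ae_restrict_iff' hboxm).2 (.of_forall hM)) c
  have hF_mem : MemLp F 2 μ := MemLp.of_bound hF.aestronglyMeasurable M hFb
  have hconj (n θ) : (starRingEnd ℂ) (e n θ) =
      Complex.exp (-Complex.I * ((∑ j, (n j : ℝ) * θ j : ℝ) : ℂ)) := by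
    simp only [e]
    rw [← Complex.exp_conj, map_mul, Complex.conj_I, Complex.conj_ofReal]
  have hint (G : (Fin d → ℝ) → ℂ) :
      ∫ θ, G θ ∂μ = ((1 / (2 * π)) ^ d : ℝ) • ∫ θ in box, G θ := by
    rw [hμ, integral_smul_measure, hcR]
  have hinner (n) {G : (Fin d → ℝ) → ℂ} (hG : MemLp G 2 μ) :
      inner ℂ ((he_mem n).toLp (e n)) (hG.toLp G) = ((1 / (2 * π)) ^ d : ℝ) •
        ∫ θ in box, Complex.exp (-Complex.I * ((∑ j, (n j : ℝ) * θ j : ℝ) : ℂ)) * G θ := by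
    rw [L2.inner_def, ← hint]
    refine integral_congr_ae ?_
    filter_upwards [(he_mem n).coeFn_toLp, hG.coeFn_toLp] with θ h1 h2
    rw [h1, h2, RCLike.inner_apply', hconj]
  have horth : Orthonormal ℂ fun n => (he_mem n).toLp (e n) := by
    rw [orthonormal_iff_ite]
    intro n m
    rw [hinner n (he_mem m)]
    have : ∀ θ : Fin d → ℝ,
        Complex.exp (-Complex.I * ((∑ j, (n j : ℝ) * θ j : ℝ) : ℂ)) * e m θ =
        Complex.exp (Complex.I * ((∑ j, ((m - n) j : ℝ) * θ j : ℝ) : ℂ)) := by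
      intro θ
      simp only [e]
      rw [← Complex.exp_add]
      congr 1
      simp only [Pi.sub_apply, Int.cast_sub, sub_mul, Finset.sum_sub_distrib]
      push_cast
      ring
    simp_rw [this]
    rw [integral_pi_Ioc_exp]
    by_cases hnm : n = m
    · subst hnm
      have h2 : (2 * (π : ℂ)) ≠ 0 := by exact_mod_cast Real.two_pi_pos.ne'
      simp only [sub_self, if_true, Complex.real_smul]
      push_cast
      rw [← mul_pow, one_div_mul_cancel h2, one_pow]
    · have : m - n ≠ 0 := sub_ne_zero.2 (Ne.symm hnm)
      simp [this, hnm]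
  have key := horth.sum_inner_products_le (hF_mem.toLp F) (s := S)
  simp_rw [hinner _ hF_mem] at key
  refine key.trans ?_
  have hnorm : ‖hF_mem.toLp F‖ ^ 2 = ∫ θ, ‖F θ‖ ^ 2 ∂μ := by
    have h1 := L2.inner_def (𝕜 := ℂ) (hF_mem.toLp F) (hF_mem.toLp F)
    rw [inner_self_eq_norm_sq_to_K] at h1
    have h2 : ∫ θ, inner ℂ ((hF_mem.toLp F : (Fin d → ℝ) → ℂ) θ)
        ((hF_mem.toLp F : (Fin d → ℝ) → ℂ) θ) ∂μ = ((∫ θ, ‖F θ‖ ^ 2 ∂μ : ℝ) : ℂ) := by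
      rw [← integral_complex_ofReal]
      refine integral_congr_ae ?_
      filter_upwards [hF_mem.coeFn_toLp] with θ h3
      rw [h3, inner_self_eq_norm_sq_to_K]
      norm_cast
    rw [h2] at h1
    rw [← RCLike.ofReal_pow] at h1
    exact Complex.ofReal_injective h1
  rw [hnorm, hμ, integral_smul_measure, hcR, smul_eq_mul]
  have hle := norm_setIntegral_le_of_norm_le_const (f := fun θ => ‖F θ‖ ^ 2) (C := M ^ 2) hvol
    (fun θ hθ => by
      rw [norm_pow, norm_norm]
      exact pow_le_pow_left₀ (norm_nonneg _) (hM θ hθ) 2)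
  rw [volume_real_pi_Ioc] at hle
  have h2 : (2 * π) ≠ 0 := Real.two_pi_pos.ne'
  calc (1 / (2 * π)) ^ d * ∫ θ in box, ‖F θ‖ ^ 2
      ≤ (1 / (2 * π)) ^ d * (M ^ 2 * (2 * π) ^ d) :=
        mul_le_mul_of_nonneg_left ((le_abs_self _).trans hle) hc0
    _ = M ^ 2 := by
        rw [mul_left_comm, ← mul_pow, one_div_mul_cancel h2, one_pow, mul_one]

/-- A smooth function agreeing with `y⁻¹` for `|y| ≥ c`. -/
def cutoffInv (c y : ℝ) : ℝ := y / (y ^ 2 + Real.smoothTransition (1 - y ^ 2 / c ^ 2))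

lemma contDiff_cutoffInv (c : ℝ) : ContDiff ℝ (⊤ : ℕ∞) (cutoffInv c) := by
  unfold cutoffInv
  refine ContDiff.div contDiff_id ?_ fun y => ?_
  · exact (contDiff_id.pow 2).add (Real.smoothTransition.contDiff.comp
      (contDiff_const.sub ((contDiff_id.pow 2).div_const _)))
  · rcases eq_or_ne y 0 with rfl | hy
    · simp
    · have := Real.smoothTransition.nonneg (1 - y ^ 2 / c ^ 2)
      positivity

lemma mul_cutoffInv {c y : ℝ} (hc : 0 < c) (hy : c ≤ |y|) : y * cutoffInv c y = 1 := by
  have h1 : c ^ 2 ≤ y ^ 2 := by rw [← sq_abs y]; gcongr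
  have h2 : 1 - y ^ 2 / c ^ 2 ≤ 0 := by
    rw [sub_nonpos, one_le_div (by positivity)]; exact h1
  have h3 : y ≠ 0 := fun h => by simp [h] at hy; linarith
  unfold cutoffInv
  rw [Real.smoothTransition.zero_of_nonpos h2, add_zero]
  field_simp

/-- The operator `B ↦ ∂₀ (ρ (τ + g) B)` produced, up to scalars, by an integration by parts in `θ₀`,
acting on amplitudes depending on a frequency parameter `τ` and on `θ`. -/
def phaseStep {n : ℕ} (ρ g : ℝ → ℝ) (B : ℝ × (Fin (n + 1) → ℝ) → ℂ) :
    ℝ × (Fin (n + 1) → ℝ) → ℂ :=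
  fun x => fderiv ℝ (fun y => (ρ (y.1 + g (y.2 0)) : ℂ) * B y) x (0, Pi.single 0 1)

section phaseStep

variable {n : ℕ} {ρ g : ℝ → ℝ} {B : ℝ × (Fin (n + 1) → ℝ) → ℂ}

lemma contDiff_phaseStep_integrand {k : WithTop ℕ∞} (hρ : ContDiff ℝ k ρ) (hg : ContDiff ℝ k g)
    (hB : ContDiff ℝ k B) : ContDiff ℝ k fun y => (ρ (y.1 + g (y.2 0)) : ℂ) * B y := by
  have h0 : ContDiff ℝ k fun y : ℝ × (Fin (n + 1) → ℝ) => y.2 0 :=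
    (contDiff_apply ℝ ℝ (0 : Fin (n + 1))).comp contDiff_snd
  exact (Complex.ofRealCLM.contDiff.comp (hρ.comp (contDiff_fst.add (hg.comp h0)))).mul hB

lemma ContDiff.phaseStep {k m : WithTop ℕ∞} (hρ : ContDiff ℝ k ρ) (hg : ContDiff ℝ k g)
    (hB : ContDiff ℝ k B) (hm : m + 1 ≤ k) : ContDiff ℝ m (phaseStep ρ g B) :=
  ((contDiff_phaseStep_integrand hρ hg hB).fderiv_right hm).clm_apply contDiff_const

lemma phaseStep_add_period {a : ℝ} (hg : Function.Periodic g a)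
    (hB : ∀ x, B (x + (0, Pi.single 0 a)) = B x) (x : ℝ × (Fin (n + 1) → ℝ)) :
    phaseStep ρ g B (x + (0, Pi.single 0 a)) = phaseStep ρ g B x := by
  unfold phaseStep
  rw [← fderiv_comp_add_right]
  congr 2
  funext y
  simp [hB, hg _]

lemma phaseStep_eq_zero_of_notMem {K : Set (Fin (n + 1) → ℝ)} (hK : IsClosed K)
    (hB : ∀ x, x.2 ∉ K → B x = 0) (x : ℝ × (Fin (n + 1) → ℝ)) (hx : x.2 ∉ K) :
    phaseStep ρ g B x = 0 := by
  have hev : (fun y => (ρ (y.1 + g (y.2 0)) : ℂ) * B y) =ᶠ[nhds x] fun _ => 0 := by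
    filter_upwards [(hK.isOpen_compl.preimage continuous_snd).mem_nhds hx] with y hy
    rw [hB y hy, mul_zero]
  unfold phaseStep
  rw [hev.fderiv_eq]
  simp

end phaseStep

lemma integral_fderiv_single_zero {n : ℕ} {G : (Fin (n + 1) → ℝ) → ℂ} (hG : ContDiff ℝ 1 G)
    {a : ℝ} (ha : 0 ≤ a) (hper : ∀ θ, G (θ + Pi.single 0 a) = G θ) :
    ∫ θ in Set.Icc (0 : Fin (n + 1) → ℝ) (fun _ => a), fderiv ℝ G θ (Pi.single 0 1) = 0 := by
  have hcont : Continuous fun θ => fderiv ℝ G θ (Pi.single 0 1) :=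
    (hG.continuous_fderiv one_ne_zero).clm_apply continuous_const
  let f : Fin (n + 1) → (Fin (n + 1) → ℝ) → ℂ := fun i => if i = 0 then G else 0
  let f' : Fin (n + 1) → (Fin (n + 1) → ℝ) → (Fin (n + 1) → ℝ) →L[ℝ] ℂ :=
    fun i => if i = 0 then fderiv ℝ G else 0
  have hsum (θ : Fin (n + 1) → ℝ) :
      ∑ i, f' i θ (Pi.single i 1) = fderiv ℝ G θ (Pi.single 0 1) := by
    rw [Finset.sum_eq_single 0 (fun i _ hi => by simp [f', hi]) (by simp)]
    simp [f']
  have key := integral_divergence_of_hasFDerivAt_off_countable' (E := ℂ)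
    (0 : Fin (n + 1) → ℝ) (fun _ => a) (fun _ => ha) f f' ∅ Set.countable_empty
    (fun i => by
      by_cases hi : i = 0
      · simpa [f, hi] using hG.continuous.continuousOn
      · simp only [f, hi, if_false]; exact continuousOn_const)
    (fun θ _ i => by
      by_cases hi : i = 0
      · simpa [f, f', hi] using (hG.differentiable one_ne_zero θ).hasFDerivAt
      · simp only [f, f', hi, if_false]; exact hasFDerivAt_const (0 : ℂ) θ)
    (by
      simp_rw [hsum]
      exact hcont.continuousOn.integrableOn_compact isCompact_Icc)
  simp_rw [hsum] at key
  rw [key]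
  refine Finset.sum_eq_zero fun i _ => ?_
  by_cases hi : i = 0
  · subst hi
    rw [sub_eq_zero]
    refine integral_congr_ae (.of_forall fun θ => ?_)
    have : (Fin.insertNth 0 a θ : Fin (n + 1) → ℝ) =
        Fin.insertNth 0 ((0 : Fin (n + 1) → ℝ) 0) θ + Pi.single 0 a := by
      ext j
      refine Fin.cases ?_ (fun j => ?_) j <;> simp
    simp only [f, if_true]
    rw [this, hper]
  · simp [f, hi]

/-- Integration by parts against an oscillating factor with phase `Φ`. -/
lemma integral_exp_phase_mul_eq {n : ℕ} {ρ g : ℝ → ℝ} {B : ℝ × (Fin (n + 1) → ℝ) → ℂ}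
    {Φ : (Fin (n + 1) → ℝ) → ℝ} {s τ a : ℝ} (ha : 0 ≤ a) (hs : s ≠ 0)
    (hρ : ContDiff ℝ 1 ρ) (hg : ContDiff ℝ 1 g) (hB : ContDiff ℝ 1 B) (hΦ : ContDiff ℝ 1 Φ)
    (hgper : Function.Periodic g a) (hBper : ∀ x, B (x + (0, Pi.single 0 a)) = B x)
    (hΦper : ∀ θ, Complex.exp (-Complex.I * Φ (θ + Pi.single 0 a)) =
      Complex.exp (-Complex.I * Φ θ))
    (hΦ' : ∀ θ, fderiv ℝ Φ θ (Pi.single 0 1) = s * (τ + g (θ 0)))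
    (hinv : ∀ θ, B (τ, θ) ≠ 0 → (τ + g (θ 0)) * ρ (τ + g (θ 0)) = 1) :
    ∫ θ in Set.Icc (0 : Fin (n + 1) → ℝ) (fun _ => a), Complex.exp (-Complex.I * Φ θ) * B (τ, θ) =
      (Complex.I * s)⁻¹ * ∫ θ in Set.Icc (0 : Fin (n + 1) → ℝ) (fun _ => a),
        Complex.exp (-Complex.I * Φ θ) * phaseStep ρ g B (τ, θ) := by
  have hH := contDiff_phaseStep_integrand hρ hg hB
  set H : ℝ × (Fin (n + 1) → ℝ) → ℂ := fun y => (ρ (y.1 + g (y.2 0)) : ℂ) * B y with hHdef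
  have hE : ContDiff ℝ 1 fun θ => Complex.exp (-Complex.I * Φ θ) :=
    (contDiff_const.mul (Complex.ofRealCLM.contDiff.comp hΦ)).cexp
  have hHτ : ContDiff ℝ 1 fun θ => H (τ, θ) := hH.comp (contDiff_const.prodMk contDiff_id)
  have hzero := integral_fderiv_single_zero (hE.mul hHτ) ha fun θ => by
    have h1 := hBper (τ, θ)
    simp only [Prod.mk_add_mk, add_zero] at h1
    simp only [hHdef, hΦper, h1, Pi.add_apply, Pi.single_eq_same, hgper (θ 0)]
  have hderiv (θ : Fin (n + 1) → ℝ) :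
      fderiv ℝ (fun θ => Complex.exp (-Complex.I * Φ θ) * H (τ, θ)) θ (Pi.single 0 1) =
        Complex.exp (-Complex.I * Φ θ) * phaseStep ρ g B (τ, θ) -
          (Complex.I * s) * (Complex.exp (-Complex.I * Φ θ) * B (τ, θ)) := by
    have hΦd : HasFDerivAt (fun θ => (Φ θ : ℂ)) (Complex.ofRealCLM.comp (fderiv ℝ Φ θ)) θ :=
      Complex.ofRealCLM.hasFDerivAt.comp θ (hΦ.differentiable one_ne_zero θ).hasFDerivAt
    have hEd := (hΦd.const_mul (-Complex.I)).cexp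
    have hHd : HasFDerivAt (fun θ => H (τ, θ)) _ θ :=
      (hH.differentiable one_ne_zero (τ, θ)).hasFDerivAt.comp θ (hasFDerivAt_prodMk_right τ θ)
    rw [(hEd.fun_mul hHd).fderiv]
    simp only [add_apply, smul_apply,
      ContinuousLinearMap.comp_apply, ContinuousLinearMap.inr_apply, smul_eq_mul,
      Complex.ofRealCLM_apply, hΦ']
    change Complex.exp (-Complex.I * Φ θ) * phaseStep ρ g B (τ, θ) + _ = _
    by_cases hb : B (τ, θ) = 0
    · simp [hHdef, hb]
    · have h1 : ((τ : ℂ) + g (θ 0)) * ρ (τ + g (θ 0)) = 1 := by exact_mod_cast hinv θ hb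
      simp only [hHdef]
      push_cast
      linear_combination (-Complex.I * s * Complex.exp (-Complex.I * Φ θ) * B (τ, θ)) * h1
  have hP : Continuous fun θ => phaseStep ρ g B (τ, θ) :=
    (ContDiff.phaseStep (m := 0) hρ hg hB (by simp)).continuous.comp (by fun_prop)
  have hBτ : Continuous fun θ => B (τ, θ) := hB.continuous.comp (by fun_prop)
  have hint1 : IntegrableOn (fun θ => Complex.exp (-Complex.I * Φ θ) * phaseStep ρ g B (τ, θ))
      (Set.Icc 0 fun _ => a) :=
    (hE.continuous.mul hP).continuousOn.integrableOn_compact isCompact_Icc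
  have hint2 : IntegrableOn (fun θ => Complex.exp (-Complex.I * Φ θ) * B (τ, θ))
      (Set.Icc 0 fun _ => a) :=
    (hE.continuous.mul hBτ).continuousOn.integrableOn_compact isCompact_Icc
  simp_rw [hderiv] at hzero
  rw [integral_sub hint1 (hint2.const_mul _), integral_const_mul, sub_eq_zero] at hzero
  have hIs : Complex.I * (s : ℂ) ≠ 0 :=
    mul_ne_zero Complex.I_ne_zero (by exact_mod_cast hs)
  rw [hzero, inv_mul_cancel_left₀ hIs]

/-- Three integrations by parts: the amplitude `B` is independent of `s`, the phase and depends
on the frequency only through the rescaled parameter `τ`. -/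
lemma exists_amplitude {n : ℕ} {g : ℝ → ℝ} {φ : (Fin (n + 1) → ℝ) → ℂ} {v a : ℝ} (ha : 0 ≤ a)
    (hv : 0 < v) (hg : ContDiff ℝ 3 g) (hgper : Function.Periodic g a) (hφ : ContDiff ℝ 3 φ)
    (hφper : ∀ θ, φ (θ + Pi.single 0 a) = φ θ) (hsupp : ∀ θ ∈ tsupport φ, v ≤ |g (θ 0)|) :
    ∃ B : ℝ × (Fin (n + 1) → ℝ) → ℂ, Continuous B ∧
      ∀ (s τ : ℝ) (Φ : (Fin (n + 1) → ℝ) → ℝ), s ≠ 0 → |τ| ≤ v / 4 → ContDiff ℝ 1 Φ →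
        (∀ θ, Complex.exp (-Complex.I * Φ (θ + Pi.single 0 a)) =
          Complex.exp (-Complex.I * Φ θ)) →
        (∀ θ, fderiv ℝ Φ θ (Pi.single 0 1) = s * (τ + g (θ 0))) →
        ∫ θ in Set.Icc (0 : Fin (n + 1) → ℝ) (fun _ => a), Complex.exp (-Complex.I * Φ θ) * φ θ =
          (Complex.I * s)⁻¹ ^ 3 * ∫ θ in Set.Icc (0 : Fin (n + 1) → ℝ) (fun _ => a),
            Complex.exp (-Complex.I * Φ θ) * B (τ, θ) := by
  have hρ : ContDiff ℝ 3 (cutoffInv (v / 2)) := contDiff_infty.1 (contDiff_cutoffInv _) 3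
  set ρ := cutoffInv (v / 2) with hρdef
  set B₀ : ℝ × (Fin (n + 1) → ℝ) → ℂ := fun x => φ x.2 with hB₀
  have c₀ : ContDiff ℝ 3 B₀ := hφ.comp contDiff_snd
  have p₀ : ∀ x, B₀ (x + (0, Pi.single 0 a)) = B₀ x := fun x => by simp [hB₀, hφper]
  have z₀ : ∀ x, x.2 ∉ tsupport φ → B₀ x = 0 := fun x hx =>
    image_eq_zero_of_notMem_tsupport (f := φ) hx
  have hK : IsClosed (tsupport φ) := isClosed_tsupport φ
  have c₁ : ContDiff ℝ 2 (phaseStep ρ g B₀) := ContDiff.phaseStep hρ hg c₀ (by norm_num)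
  have c₂ : ContDiff ℝ 1 (phaseStep ρ g (phaseStep ρ g B₀)) :=
    ContDiff.phaseStep (k := 2) (hρ.of_le (by norm_num)) (hg.of_le (by norm_num)) c₁ (by norm_num)
  have hρ₁ : ContDiff ℝ 1 ρ := hρ.of_le (by norm_num)
  have hg₁ : ContDiff ℝ 1 g := hg.of_le (by norm_num)
  have c₃ : ContDiff ℝ 0 (phaseStep ρ g (phaseStep ρ g (phaseStep ρ g B₀))) :=
    ContDiff.phaseStep (k := 1) hρ₁ hg₁ c₂ (by norm_num)
  have p₁ := phaseStep_add_period (ρ := ρ) hgper p₀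
  have p₂ := phaseStep_add_period (ρ := ρ) hgper p₁
  have z₁ := phaseStep_eq_zero_of_notMem (ρ := ρ) (g := g) hK z₀
  have z₂ := phaseStep_eq_zero_of_notMem (ρ := ρ) (g := g) hK z₁
  refine ⟨_, c₃.continuous, fun s τ Φ hs hτ hΦ hΦper hΦ' => ?_⟩
  have hinv {B : ℝ × (Fin (n + 1) → ℝ) → ℂ} (hB : ∀ x, x.2 ∉ tsupport φ → B x = 0)
      (θ : Fin (n + 1) → ℝ) (hne : B (τ, θ) ≠ 0) :
      (τ + g (θ 0)) * ρ (τ + g (θ 0)) = 1 := by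
    have hθ : θ ∈ tsupport φ := by
      by_contra hcon
      exact hne (hB (τ, θ) hcon)
    refine mul_cutoffInv (half_pos hv) ?_
    have h1 := hsupp θ hθ
    have h2 := abs_sub_abs_le_abs_sub (g (θ 0)) (-τ)
    rw [abs_neg, sub_neg_eq_add, add_comm (g (θ 0))] at h2
    linarith
  have i₀ := integral_exp_phase_mul_eq ha hs hρ₁ hg₁ (c₀.of_le (by norm_num)) hΦ hgper p₀ hΦper hΦ'
    (hinv z₀)
  have i₁ := integral_exp_phase_mul_eq ha hs hρ₁ hg₁ (c₁.of_le (by norm_num)) hΦ hgper p₁ hΦper hΦ'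
    (hinv z₁)
  have i₂ := integral_exp_phase_mul_eq ha hs hρ₁ hg₁ c₂ hΦ hgper p₂ hΦper hΦ' (hinv z₂)
  rw [i₁, i₂] at i₀
  simp only [hB₀] at i₀ ⊢
  rw [i₀]
  ring

lemma hasFDerivAt_sum_add_mul_sum {d : ℕ} {h : Fin d → ℝ → ℝ} (hd : ∀ j, Differentiable ℝ (h j))
    (c : Fin d → ℝ) (s : ℝ) (θ : Fin d → ℝ) :
    HasFDerivAt (fun θ : Fin d → ℝ => (∑ j, c j * θ j) + s * ∑ j, h j (θ j))
      ((∑ j, c j • ContinuousLinearMap.proj (R := ℝ) (φ := fun _ : Fin d => ℝ) j) +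
        s • ∑ j, deriv (h j) (θ j) •
          ContinuousLinearMap.proj (R := ℝ) (φ := fun _ : Fin d => ℝ) j) θ :=
  (HasFDerivAt.fun_sum fun j _ => (hasFDerivAt_apply j θ).const_mul (c j)).add
    ((HasFDerivAt.fun_sum fun j _ =>
      (hd j (θ j)).hasDerivAt.comp_hasFDerivAt θ (hasFDerivAt_apply j θ)).const_mul s)

lemma card_Icc_floor_le {x : ℝ} (hx : 0 ≤ x) :
    ((Finset.Icc (-⌊x⌋) ⌊x⌋).card : ℝ) ≤ 2 * x + 1 := by
  have h0 : 0 ≤ ⌊x⌋ := Int.floor_nonneg.2 hx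
  have h1 : (((Finset.Icc (-⌊x⌋) ⌊x⌋).card : ℤ) : ℝ) = 2 * ⌊x⌋ + 1 := by
    rw [Int.card_Icc, Int.toNat_of_nonneg (by linarith)]
    push_cast
    ring
  have h2 := Int.floor_le x
  rw [Int.cast_natCast] at h1
  linarith

/-- Stationary phase estimate on the `ν`-torus: if `|h₁′(θ₁)| ≥ v` on the
support of the smooth function `φ`, then there is `C` such that for all `s ≥ 1`,
`∑_{|n₁| ≤ vs/4} |∫_{T^ν} e^{−i(n·θ + s h(θ))} φ(θ) dσ(θ)|² ≤ C s^{−4}`. -/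
theorem oscillatory_integral_estimate_torus
    (ν : ℕ) (hν : 0 < ν)
    (h : Fin ν → ℝ → ℝ)
    (hper : ∀ j, Function.Periodic (h j) (2 * π))
    (hsmooth : ∀ j, ContDiff ℝ (3 * ν + 3 : ℕ) (h j))
    (φ : (Fin ν → ℝ) → ℂ)
    (hφper : ∀ (θ : Fin ν → ℝ) (j : Fin ν), φ (Function.update θ j (θ j + 2 * π)) = φ θ)
    (hφsm : ContDiff ℝ (⊤ : ℕ∞) φ)
    (v : ℝ) (hv : 0 < v)
    (hsupp : ∀ θ ∈ tsupport φ, v ≤ |deriv (h ⟨0, hν⟩) (θ ⟨0, hν⟩)|) :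
    ∃ C : ℝ, ∀ s : ℝ, 1 ≤ s →
      ∑' n : { m : Fin ν → ℤ // |((m ⟨0, hν⟩ : ℤ) : ℝ)| ≤ v * s / 4 },
        ‖((1 / (2 * π)) ^ ν : ℝ) •
          ∫ θ in Set.univ.pi fun _ : Fin ν => Set.Ioc (0 : ℝ) (2 * π),
            Complex.exp (-Complex.I *
                (((∑ j, ((n : Fin ν → ℤ) j : ℝ) * θ j) + s * ∑ j, h j (θ j) : ℝ) : ℂ)) *
              φ θ‖ ^ 2
        ≤ C / s ^ 4 := by
  obtain ⟨n, rfl⟩ : ∃ n, ν = n + 1 := ⟨ν - 1, by omega⟩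
  simp only [Fin.mk_zero'] at hsupp ⊢
  have hh (k : ℕ) (hk : k ≤ 5) (j) : ContDiff ℝ (k + 1 : ℕ) (h j) :=
    (hsmooth j).of_le (by exact_mod_cast (by omega))
  have hh₁ (j) : ContDiff ℝ 1 (h j) := by simpa using hh 0 (by norm_num) j
  have hg : ContDiff ℝ 3 (deriv (h 0)) := by
    have h4 := hh 3 (by norm_num) 0
    rw [Nat.cast_add, Nat.cast_one, contDiff_succ_iff_deriv] at h4
    exact_mod_cast h4.2.2
  have hgper : Function.Periodic (deriv (h 0)) (2 * π) := fun t => by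
    rw [← deriv_comp_add_const]
    congr 1
    exact funext (hper 0)
  have hφper' (θ : Fin (n + 1) → ℝ) : φ (θ + Pi.single 0 (2 * π)) = φ θ := by
    rw [← hφper θ 0]
    congr 1
    ext j
    by_cases hj : j = 0
    · subst hj; simp
    · simp [hj]
  obtain ⟨B, hBcont, hB⟩ := exists_amplitude Real.two_pi_pos.le hv hg hgper
    (contDiff_infty.1 hφsm 3) hφper' hsupp
  obtain ⟨M, hM⟩ := (isCompact_Icc.prod isCompact_Icc :
    IsCompact (Set.Icc (-(v / 4)) (v / 4) ×ˢ
      Set.Icc (0 : Fin (n + 1) → ℝ) (fun _ => 2 * π))).exists_bound_of_continuousOn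
        hBcont.continuousOn
  have hbox {f : (Fin (n + 1) → ℝ) → ℂ} :
      ∫ θ in Set.univ.pi fun _ : Fin (n + 1) => Set.Ioc (0 : ℝ) (2 * π), f θ =
        ∫ θ in Set.Icc (0 : Fin (n + 1) → ℝ) (fun _ => 2 * π), f θ :=
    setIntegral_congr_set (Measure.univ_pi_Ioc_ae_eq_Icc (f := (0 : Fin (n + 1) → ℝ)))
  refine ⟨(v / 2 + 1) * M ^ 2, fun s hs => ?_⟩
  have hs0 : 0 < s := by linarith
  let F : ℤ → (Fin (n + 1) → ℝ) → ℂ := fun k θ =>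
    Complex.exp (-Complex.I * ((s * ∑ j, h j (θ j) : ℝ) : ℂ)) * B (k / s, θ)
  have hFcont (k : ℤ) : Continuous (F k) := by
    have (j : Fin (n + 1)) : Continuous (h j) := (hh₁ j).continuous
    fun_prop
  have hτ {k : ℤ} (hk : |(k : ℝ)| ≤ v * s / 4) : |(k : ℝ) / s| ≤ v / 4 := by
    rw [abs_div, abs_of_pos hs0, div_le_iff₀ hs0]
    linarith
  have hFbound {k : ℤ} (hk : |(k : ℝ)| ≤ v * s / 4) :
      ∀ θ ∈ Set.univ.pi fun _ : Fin (n + 1) => Set.Ioc (0 : ℝ) (2 * π), ‖F k θ‖ ≤ M := by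
    intro θ hθ
    have h1 := hM ((k : ℝ) / s, θ) ⟨abs_le.1 (hτ hk), fun j => (hθ j trivial).1.le,
      fun j => (hθ j trivial).2⟩
    simp only [F, norm_mul]
    rw [neg_mul, ← mul_neg, mul_comm Complex.I, ← Complex.ofReal_neg,
      Complex.norm_exp_ofReal_mul_I, one_mul]
    exact h1
  let coeff : (Fin (n + 1) → ℤ) → ℝ := fun m => ‖((1 / (2 * π)) ^ (n + 1) : ℝ) •
    ∫ θ in Set.univ.pi fun _ : Fin (n + 1) => Set.Ioc (0 : ℝ) (2 * π),
      Complex.exp (-Complex.I * ((∑ j, (m j : ℝ) * θ j : ℝ) : ℂ)) * F (m 0) θ‖ ^ 2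
  have hterm (m : Fin (n + 1) → ℤ) (hm : |((m 0 : ℤ) : ℝ)| ≤ v * s / 4) :
      ‖((1 / (2 * π)) ^ (n + 1) : ℝ) •
          ∫ θ in Set.univ.pi fun _ : Fin (n + 1) => Set.Ioc (0 : ℝ) (2 * π),
            Complex.exp (-Complex.I *
                (((∑ j, (m j : ℝ) * θ j) + s * ∑ j, h j (θ j) : ℝ) : ℂ)) *
              φ θ‖ ^ 2 = (s ^ 6)⁻¹ * coeff m := by
    have hd := hasFDerivAt_sum_add_mul_sum
      (fun j => (hh₁ j).differentiable one_ne_zero) (fun j => (m j : ℝ)) s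
    have hibp := hB s (m 0 / s) (fun θ => (∑ j, (m j : ℝ) * θ j) + s * ∑ j, h j (θ j)) hs0.ne'
      (hτ hm)
      (by
        refine ContDiff.add (ContDiff.sum fun j _ => contDiff_const.mul (contDiff_apply ℝ ℝ j)) ?_
        exact contDiff_const.mul (ContDiff.sum fun j _ => (hh₁ j).comp (contDiff_apply ℝ ℝ j)))
      (fun θ => by
        have hsum1 : ∑ j, (m j : ℝ) * (θ + Pi.single 0 (2 * π) : Fin (n + 1) → ℝ) j =
            (∑ j, (m j : ℝ) * θ j) + m 0 * (2 * π) := by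
          simp [mul_add, Finset.sum_add_distrib, Pi.single_apply]
        have hsum2 : ∑ j, h j ((θ + Pi.single 0 (2 * π) : Fin (n + 1) → ℝ) j) =
            ∑ j, h j (θ j) := by
          refine Finset.sum_congr rfl fun j _ => ?_
          by_cases hj : j = 0
          · subst hj; simp [hper 0 (θ 0)]
          · simp [hj]
        rw [hsum1, hsum2, Complex.exp_eq_exp_iff_exists_int]
        exact ⟨-m 0, by push_cast; ring⟩)
      (fun θ => by
        rw [(hd θ).fderiv]
        simp [Pi.single_apply]
        field_simp)
    rw [hbox, hibp, ← hbox]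
    have hsplit (θ : Fin (n + 1) → ℝ) :
        Complex.exp (-Complex.I * (((∑ j, (m j : ℝ) * θ j) + s * ∑ j, h j (θ j) : ℝ) : ℂ)) *
          B (m 0 / s, θ) =
        Complex.exp (-Complex.I * ((∑ j, (m j : ℝ) * θ j : ℝ) : ℂ)) * F (m 0) θ := by
      simp only [F]
      rw [← mul_assoc, ← Complex.exp_add, ← mul_add, ← Complex.ofReal_add]
    simp_rw [hsplit]
    rw [← mul_smul_comm, norm_mul, mul_pow]
    congr 1
    rw [norm_pow, norm_inv, norm_mul, Complex.norm_I, one_mul, Complex.norm_real,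
      Real.norm_of_nonneg hs0.le]
    ring
  refine Real.tsum_le_of_sum_le (fun _ => sq_nonneg _) fun S => ?_
  rw [Finset.sum_congr rfl fun m _ => hterm m.1 m.2, ← Finset.mul_sum]
  have hmaps : ∀ m ∈ S, m.1 0 ∈ Finset.Icc (-⌊v * s / 4⌋) ⌊v * s / 4⌋ := fun m _ => by
    have h1 := abs_le.1 m.2
    rw [Finset.mem_Icc]
    constructor
    · rw [neg_le]
      exact Int.le_floor.2 (by push_cast; linarith)
    · exact Int.le_floor.2 h1.2
  have hfiber (k : ℤ) : ∑ m ∈ S with m.1 0 = k, coeff m.1 ≤ M ^ 2 := by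
    by_cases hk : |(k : ℝ)| ≤ v * s / 4
    · refine le_trans (le_of_eq ?_) (sum_sq_norm_fourier_coeff_le (hFcont k) (hFbound hk)
        ((S.filter fun m => m.1 0 = k).map (Function.Embedding.subtype _)))
      rw [Finset.sum_map]
      refine Finset.sum_congr rfl fun m hm => ?_
      simp only [coeff, Function.Embedding.subtype_apply, (Finset.mem_filter.1 hm).2]
    · rw [Finset.filter_false_of_mem fun (m : { m : Fin (n + 1) → ℤ // _ }) _ (hmk : m.1 0 = k) =>
        hk (hmk ▸ m.2), Finset.sum_empty]
      positivity
  have hsum : ∑ m ∈ S, coeff m.1 ≤ (v / 2 + 1) * s * M ^ 2 := by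
    rw [← Finset.sum_fiberwise_of_maps_to hmaps]
    refine (Finset.sum_le_card_nsmul _ _ _ fun k _ => hfiber k).trans ?_
    rw [nsmul_eq_mul]
    refine mul_le_mul_of_nonneg_right ?_ (sq_nonneg M)
    refine (card_Icc_floor_le (by positivity)).trans ?_
    nlinarith
  calc (s ^ 6)⁻¹ * ∑ m ∈ S, coeff m.1 ≤ (s ^ 6)⁻¹ * ((v / 2 + 1) * s * M ^ 2) := by gcongr
    _ = (v / 2 + 1) * M ^ 2 / s ^ 5 := by field_simp
    _ ≤ (v / 2 + 1) * M ^ 2 / s ^ 4 := by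
      gcongr
      norm_num
end
end

section
/- Let ν ≥ 1 and let h(θ) = Σ_{j=1}^ν h_j(θ_j) with each h_j : ℝ/2πℤ → ℝ of class C^{3ν+3}, and set E₊ = Σ_j sup h_j, E₋ = Σ_j inf h_j. Fix s with ν/(3ν+3) < s ≤ 1. For real E ∉ [E₋, E₊], define S(E) = Σ_{m ∈ ℤ^ν} |∫_{T^ν} e^{i m·θ} (h(θ) − E)^{−1} dσ(θ)|^s. Then S(E) < ∞ for every real E ∉ [E₋, E₊], and S(E) → 0 as |E| → ∞ (i.e. S(E) tends to 0 both as E → +∞ and as E → −∞). -/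
open MeasureTheory Complex Real Filter

noncomputable section

/-- The matrix element `⟨δ_n, (H₀ − E)^{−1} δ_{n+m}⟩ = ∫_{T^ν} e^{i m·θ} (h(θ) − E)^{−1} dσ(θ)`
of the resolvent of the convolution operator associated with `h(θ) = ∑_j h_j(θ_j)`,
realized via `(2π)`-periodic functions on `ℝ^ν`. -/
def resolventKernel (ν : ℕ) (h : Fin ν → ℝ → ℝ) (E : ℝ) (m : Fin ν → ℤ) : ℂ :=
  ((1 / (2 * π)) ^ ν : ℝ) •
    ∫ θ in Set.univ.pi fun _ : Fin ν => Set.Ioc (0 : ℝ) (2 * π),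
      Complex.exp (Complex.I * ((∑ j, (m j : ℝ) * θ j : ℝ) : ℂ)) *
        ((((∑ j, h j (θ j)) - E : ℝ) : ℂ))⁻¹

theorem abs_pow_mul_norm_integral_exp_mul_le {f : ℝ → ℝ} {n : ℕ} {B : ℝ}
    (hf : ContDiff ℝ n f) (hp : Function.Periodic f (2 * π))
    (hB : ∀ x, |iteratedDeriv n f x| ≤ B) (k : ℤ) :
    |(k : ℝ)| ^ n * ‖∫ x in (0 : ℝ)..(2 * π), cexp (I * ((k * x : ℝ) : ℂ)) * (f x : ℂ)‖
      ≤ 2 * π * B := by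
  induction n generalizing f with
  | zero =>
    have := intervalIntegral.norm_integral_le_of_norm_le_const (a := (0 : ℝ)) (b := 2 * π)
      (f := fun x : ℝ => cexp (I * ((k * x : ℝ) : ℂ)) * (f x : ℂ)) (C := B) (by
        intro x _
        rw [norm_mul, mul_comm I, Complex.norm_exp_ofReal_mul_I, one_mul, Complex.norm_real]
        simpa using hB x)
    rw [sub_zero, abs_of_pos Real.two_pi_pos] at this
    rw [pow_zero, one_mul]
    linarith
  | succ n ih =>
    have hd : ContDiff ℝ n (deriv f) := by
      have := (contDiff_succ_iff_deriv (n := n) (f := f)).1 (by exact_mod_cast hf)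
      exact this.2.2
    have hpd : Function.Periodic (deriv f) (2 * π) := by
      intro x
      rw [← deriv_comp_add_const, funext hp]
    have key := ih hd hpd (fun x => by simpa [iteratedDeriv_succ'] using hB x)
    have hdf : ∀ x, HasDerivAt (fun x => (f x : ℂ)) ((deriv f x : ℝ) : ℂ) x := fun x =>
      ((hf.differentiable (by simp)) x).hasDerivAt.ofReal_comp
    have hde : ∀ x : ℝ, HasDerivAt (fun x : ℝ => cexp (I * ((k * x : ℝ) : ℂ)))
        (cexp (I * ((k * x : ℝ) : ℂ)) * (I * k)) x := fun x => by
      have h1 : HasDerivAt (fun x : ℝ => I * ((k * x : ℝ) : ℂ)) (I * k) x := by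
        simpa using (((hasDerivAt_id x).const_mul (k : ℝ)).ofReal_comp).const_mul I
      exact h1.cexp
    have ibp := intervalIntegral.integral_mul_deriv_eq_deriv_mul (a := (0 : ℝ)) (b := 2 * π)
      (fun x _ => hde x) (fun x _ => hdf x)
      (by apply Continuous.intervalIntegrable; fun_prop)
      (by
        have := hd.continuous
        apply Continuous.intervalIntegrable; fun_prop)
    have e1 : cexp (I * ((k * (2 * π) : ℝ) : ℂ)) = 1 := by
      rw [Complex.exp_eq_one_iff]
      exact ⟨k, by push_cast; ring⟩
    have e2 : f (2 * π) = f 0 := by simpa using hp 0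
    have e3 : ∫ x in (0 : ℝ)..(2 * π), cexp (I * ((k * x : ℝ) : ℂ)) * (I * k) * (f x : ℂ)
        = (I * k) * ∫ x in (0 : ℝ)..(2 * π), cexp (I * ((k * x : ℝ) : ℂ)) * (f x : ℂ) := by
      rw [← intervalIntegral.integral_const_mul]
      congr 1 with x
      ring
    rw [e1, e2, e3] at ibp
    simp only [mul_zero, Complex.ofReal_zero, Complex.exp_zero, sub_self, zero_sub] at ibp
    rw [ibp, norm_neg, norm_mul, norm_mul, Complex.norm_I, one_mul, Complex.norm_intCast] at key
    rw [pow_succ, mul_assoc]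
    exact key

theorem abs_iteratedDeriv_inv_le {d y : ℝ} (hd : 0 < d) (hy : d ≤ |y|) {i n : ℕ} (hi : i ≤ n) :
    |iteratedDeriv i (Inv.inv : ℝ → ℝ) y| ≤ n.factorial * (d⁻¹ * max 1 d⁻¹ ^ n) := by
  have hy0 : 0 < |y| := hd.trans_le hy
  have hinv : |y|⁻¹ ≤ d⁻¹ := inv_anti₀ hd hy
  rw [iteratedDeriv_eq_iterate, iter_deriv_inv, abs_mul, abs_mul, abs_pow, abs_neg, abs_one,
    one_pow, one_mul, Nat.abs_cast, abs_zpow]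
  have h1 : |y| ^ (-1 - i : ℤ) = |y|⁻¹ * |y|⁻¹ ^ i := by
    rw [sub_eq_add_neg, zpow_add₀ hy0.ne', zpow_neg_one, zpow_neg, zpow_natCast, inv_pow]
  rw [h1]
  have h2 : |y|⁻¹ ^ i ≤ max 1 d⁻¹ ^ n :=
    (pow_le_pow_left₀ (by positivity) (hinv.trans (le_max_right _ _)) i).trans
      (pow_le_pow_right₀ (le_max_left _ _) hi)
  gcongr

theorem abs_iteratedDeriv_inv_comp_le {f : ℝ → ℝ} {n : ℕ} {c d D : ℝ} (hf : ContDiff ℝ n f)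
    (hd : 0 < d) (hlow : ∀ x, d ≤ |f x + c|)
    (hD : ∀ i, 1 ≤ i → i ≤ n → ∀ x, |iteratedDeriv i f x| ≤ D ^ i) (x : ℝ) :
    |iteratedDeriv n (fun x => (f x + c)⁻¹) x|
      ≤ n.factorial * (n.factorial * (d⁻¹ * max 1 d⁻¹ ^ n)) * D ^ n := by
  have hne : ∀ x, f x + c ≠ 0 := fun x => abs_pos.1 (hd.trans_le (hlow x))
  have key := norm_iteratedFDerivWithin_comp_le (𝕜 := ℝ) (g := (Inv.inv : ℝ → ℝ))
    (f := fun x => f x + c) (n := n) (N := n) (s := Set.univ) (t := {0}ᶜ) (x := x)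
    (C := n.factorial * (d⁻¹ * max 1 d⁻¹ ^ n)) (D := D)
    (fun y hy => (contDiffAt_inv ℝ hy).contDiffWithinAt)
    (hf.add contDiff_const).contDiffOn le_rfl
    isOpen_compl_singleton.uniqueDiffOn uniqueDiffOn_univ
    (fun y _ => hne y) (Set.mem_univ x)
    (fun i hi => by
      rw [iteratedFDerivWithin_of_isOpen i isOpen_compl_singleton (hne x),
        norm_iteratedFDeriv_eq_norm_iteratedDeriv, Real.norm_eq_abs]
      exact abs_iteratedDeriv_inv_le hd (hlow x) hi)
    (fun i h1 hi => by
      rw [iteratedFDerivWithin_univ, norm_iteratedFDeriv_eq_norm_iteratedDeriv, Real.norm_eq_abs]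
      obtain ⟨j, rfl⟩ := Nat.exists_eq_add_of_le' h1
      have := hD _ h1 hi x
      rw [iteratedDeriv_succ'] at this ⊢
      simpa using this)
  rw [iteratedFDerivWithin_univ, norm_iteratedFDeriv_eq_norm_iteratedDeriv,
    Real.norm_eq_abs] at key
  exact key

theorem exists_abs_iteratedDeriv_le_pow {f : ℝ → ℝ} {n : ℕ} {T : ℝ} (hT : T ≠ 0)
    (hf : ContDiff ℝ n f) (hp : Function.Periodic f T) :
    ∃ D, 1 ≤ D ∧ ∀ i, 1 ≤ i → i ≤ n → ∀ x, |iteratedDeriv i f x| ≤ D ^ i := by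
  have hb : ∀ i : ℕ, ∃ M, i ≤ n → ∀ x, |iteratedDeriv i f x| ≤ M := by
    intro i
    by_cases hi : i ≤ n
    · have hper : Function.Periodic (iteratedDeriv i f) T := by
        intro x
        have := congrFun (iteratedDeriv_comp_add_const i f T) x
        rw [← this, funext hp]
      obtain ⟨M, hM⟩ := (hper.isBounded_of_continuous hT
        (hf.continuous_iteratedDeriv i (by exact_mod_cast hi))).exists_norm_le
      exact ⟨M, fun _ x => hM _ ⟨x, rfl⟩⟩
    · exact ⟨0, fun h => absurd h hi⟩
  choose M hM using hb
  have hD : 1 ≤ 1 + ∑ i ∈ Finset.range (n + 1), |M i| :=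
    le_add_of_nonneg_right (Finset.sum_nonneg fun _ _ => abs_nonneg _)
  refine ⟨_, hD, fun i h1 hi x => ?_⟩
  calc |iteratedDeriv i f x| ≤ |M i| := (hM i hi x).trans (le_abs_self _)
    _ ≤ ∑ i ∈ Finset.range (n + 1), |M i| :=
      Finset.single_le_sum (f := fun i => |M i|) (fun _ _ => abs_nonneg _)
        (Finset.mem_range.2 (by omega))
    _ ≤ 1 + ∑ i ∈ Finset.range (n + 1), |M i| := by linarith
    _ ≤ _ := le_self_pow₀ hD (by omega)

theorem integral_univ_pi_Ioc_eq_integral_insertNth {n : ℕ} {a b : ℝ} (i : Fin (n + 1))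
    (F : (Fin (n + 1) → ℝ) → ℂ)
    (hF : IntegrableOn F (Set.univ.pi fun _ => Set.Ioc a b)) :
    ∫ θ in Set.univ.pi fun _ : Fin (n + 1) => Set.Ioc a b, F θ
      = ∫ y in Set.univ.pi fun _ : Fin n => Set.Ioc a b, ∫ x in Set.Ioc a b,
          F (i.insertNth x y) := by
  have hmp := measurePreserving_piFinSuccAbove
    (fun _ : Fin (n + 1) => (volume : Measure ℝ).restrict (Set.Ioc a b)) i
  have hsymm := hmp.symm
  rw [IntegrableOn, volume_pi, Measure.restrict_pi_pi] at hF
  rw [volume_pi, Measure.restrict_pi_pi, volume_pi, Measure.restrict_pi_pi,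
    ← hsymm.integral_comp', integral_prod_symm]
  · rfl
  · exact (hsymm.integrable_comp_emb (MeasurableEquiv.measurableEmbedding _)).2 hF

theorem norm_integral_univ_pi_Ioc_le {n : ℕ} {a b B : ℝ} (hab : a ≤ b) {F : (Fin n → ℝ) → ℂ}
    (hF : ∀ y, ‖F y‖ ≤ B) :
    ‖∫ y in Set.univ.pi fun _ : Fin n => Set.Ioc a b, F y‖ ≤ (b - a) ^ n * B := by
  have hvol : volume (Set.univ.pi fun _ : Fin n => Set.Ioc a b) = ENNReal.ofReal ((b - a) ^ n) := by
    rw [volume_pi_pi]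
    simp [ENNReal.ofReal_pow (sub_nonneg.2 hab)]
  have := norm_setIntegral_le_of_norm_le_const (μ := volume)
    (s := Set.univ.pi fun _ : Fin n => Set.Ioc a b) (f := F) (C := B)
    (by rw [hvol]; exact ENNReal.ofReal_lt_top) (fun y _ => hF y)
  rw [Measure.real, hvol, ENNReal.toReal_ofReal (pow_nonneg (sub_nonneg.2 hab) n)] at this
  linarith

theorem norm_resolventKernel_le {ν : ℕ} {h : Fin ν → ℝ → ℝ} {d E : ℝ} (hd : 0 < d)
    (hlow : ∀ θ : Fin ν → ℝ, d ≤ |(∑ j, h j (θ j)) - E|) (m : Fin ν → ℤ) :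
    ‖resolventKernel ν h E m‖ ≤ d⁻¹ := by
  have := norm_integral_univ_pi_Ioc_le (n := ν) Real.two_pi_pos.le (B := d⁻¹)
    (F := fun θ => cexp (I * ((∑ j, (m j : ℝ) * θ j : ℝ) : ℂ)) *
        ((((∑ j, h j (θ j)) - E : ℝ) : ℂ))⁻¹) (fun θ => by
      rw [norm_mul, mul_comm I, Complex.norm_exp_ofReal_mul_I, one_mul, norm_inv,
        Complex.norm_real, Real.norm_eq_abs]
      exact inv_anti₀ hd (hlow θ))
  have hpi := Real.two_pi_pos
  rw [resolventKernel, norm_smul, Real.norm_of_nonneg (by positivity)]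
  refine (mul_le_mul_of_nonneg_left this (by positivity)).trans (le_of_eq ?_)
  rw [sub_zero, ← mul_assoc, ← mul_pow, one_div_mul_cancel hpi.ne', one_pow, one_mul]

theorem abs_pow_mul_norm_resolventKernel_le {ν N : ℕ} {h : Fin ν → ℝ → ℝ} {d D E : ℝ}
    (hper : ∀ j, Function.Periodic (h j) (2 * π)) (hsmooth : ∀ j, ContDiff ℝ N (h j))
    (hd : 0 < d) (hlow : ∀ θ : Fin ν → ℝ, d ≤ |(∑ j, h j (θ j)) - E|) (i : Fin ν)
    (hD : ∀ k, 1 ≤ k → k ≤ N → ∀ x, |iteratedDeriv k (h i) x| ≤ D ^ k) (m : Fin ν → ℤ) :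
    |(m i : ℝ)| ^ N * ‖resolventKernel ν h E m‖
      ≤ N.factorial * (N.factorial * (d⁻¹ * max 1 d⁻¹ ^ N)) * D ^ N := by
  obtain _ | n := ν
  · exact i.elim0
  have hpi := Real.two_pi_pos
  set F : (Fin (n + 1) → ℝ) → ℂ := fun θ => cexp (I * ((∑ j, (m j : ℝ) * θ j : ℝ) : ℂ)) *
        ((((∑ j, h j (θ j)) - E : ℝ) : ℂ))⁻¹ with hFdef
  have hcont : Continuous F := by
    have hc : ∀ j, Continuous (h j) := fun j => (hsmooth j).continuous
    have hne : ∀ θ : Fin (n + 1) → ℝ, (((∑ j, h j (θ j)) - E : ℝ) : ℂ) ≠ 0 := fun θ =>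
      Complex.ofReal_ne_zero.2 (abs_pos.1 (hd.trans_le (hlow θ)))
    refine Continuous.mul (by fun_prop) (Continuous.inv₀ ?_ hne)
    fun_prop
  have hint : IntegrableOn F (Set.univ.pi fun _ => Set.Ioc 0 (2 * π)) :=
    (hcont.continuousOn.integrableOn_compact
      (isCompact_univ_pi fun _ => isCompact_Icc (a := (0 : ℝ)) (b := 2 * π))).mono_set
      (Set.pi_mono fun _ _ => Set.Ioc_subset_Icc_self)
  set A : ℝ := N.factorial * (N.factorial * (d⁻¹ * max 1 d⁻¹ ^ N)) * D ^ N with hA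
  have hinner : ∀ y : Fin n → ℝ, ‖((|(m i : ℝ)| ^ N : ℝ) : ℂ) *
      ∫ x in Set.Ioc 0 (2 * π), F (i.insertNth x y)‖ ≤ 2 * π * A := by
    intro y
    set c : ℝ := (∑ k, h (i.succAbove k) (y k)) - E with hc
    have hlow' : ∀ x, d ≤ |h i x + c| := fun x => by
      have := hlow (i.insertNth x y)
      rwa [Fin.sum_univ_succAbove _ i, Fin.insertNth_apply_same, add_sub_assoc,
        Finset.sum_congr rfl fun k _ => by rw [Fin.insertNth_apply_succAbove]] at this
    have hne : ∀ x, h i x + c ≠ 0 := fun x => abs_pos.1 (hd.trans_le (hlow' x))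
    have key := abs_pow_mul_norm_integral_exp_mul_le (n := N) (f := fun x => (h i x + c)⁻¹) (B := A)
      (((hsmooth i).add contDiff_const).inv hne) (fun x => by simp only [hper i x])
      (abs_iteratedDeriv_inv_comp_le (hsmooth i) hd hlow' hD) (m i)
    have hsplit : ∀ x, F (i.insertNth x y)
        = cexp (((∑ k, (m (i.succAbove k) : ℝ) * y k : ℝ) : ℂ) * I) *
          (cexp (I * ((m i * x : ℝ) : ℂ)) * (((h i x + c)⁻¹ : ℝ) : ℂ)) := fun x => by
      have e : (∑ j, h j ((i.insertNth x y : Fin (n + 1) → ℝ) j)) - E = h i x + c := by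
        simp [Fin.sum_univ_succAbove _ i, hc, add_sub_assoc]
      have e' : ∑ j, (m j : ℝ) * (i.insertNth x y : Fin (n + 1) → ℝ) j
          = m i * x + ∑ k, (m (i.succAbove k) : ℝ) * y k := by
        simp [Fin.sum_univ_succAbove _ i]
      rw [hFdef]
      simp only [e, e']
      rw [← mul_assoc, ← Complex.exp_add, Complex.ofReal_inv, Complex.ofReal_add (m i * x)]
      congr 2
      ring
    simp_rw [hsplit]
    rw [integral_const_mul, ← intervalIntegral.integral_of_le hpi.le, norm_mul, norm_mul,
      Complex.norm_exp_ofReal_mul_I, one_mul, Complex.norm_real,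
      Real.norm_of_nonneg (by positivity)]
    exact key
  have hout := norm_integral_univ_pi_Ioc_le hpi.le hinner
  rw [integral_const_mul, ← integral_univ_pi_Ioc_eq_integral_insertNth i F hint, norm_mul,
    Complex.norm_real, Real.norm_of_nonneg (by positivity), sub_zero] at hout
  rw [resolventKernel, norm_smul, Real.norm_of_nonneg (by positivity)]
  change |(m i : ℝ)| ^ N * ((1 / (2 * π)) ^ (n + 1) * ‖∫ θ in _, F θ‖) ≤ A
  rw [mul_left_comm]
  refine (mul_le_mul_of_nonneg_left hout (by positivity)).trans (le_of_eq ?_)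
  rw [← mul_assoc ((2 * π) ^ n), ← pow_succ, ← mul_assoc, ← mul_pow, one_div_mul_cancel hpi.ne',
    one_pow, one_mul]

theorem summable_norm_int_rpow {ι : Type*} [Fintype ι] {r : ℝ} (hr : r < -Fintype.card ι) :
    Summable fun m : ι → ℤ => ‖m‖ ^ r := by
  classical
  let L := Submodule.span ℤ (Set.range (Pi.basisFun ℝ ι))
  have hrank : Module.finrank ℤ L = Fintype.card ι := by
    rw [ZLattice.rank ℝ L]
    simp
  have hs := ZLattice.summable_norm_rpow L r (by rwa [hrank])
  let φ : (ι → ℤ) → L := fun m => ⟨fun j => (m j : ℝ), by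
    rw [(Pi.basisFun ℝ ι).mem_span_iff_repr_mem ℤ]
    intro j
    exact ⟨m j, by simp⟩⟩
  have hφ : Function.Injective φ := fun m m' hmm => by
    funext j
    have : (m j : ℝ) = m' j := congrFun (congrArg Subtype.val hmm) j
    exact_mod_cast this
  refine (hs.comp_injective hφ).congr fun m => ?_
  have : ‖(φ m : ι → ℝ)‖ = ‖m‖ := by
    simp only [Pi.norm_def, φ]
    congr 2
  change ‖(φ m : ι → ℝ)‖ ^ r = _
  rw [this]

theorem norm_rpow_le_mul_of_norm_pow_mul_le {ι : Type*} [Fintype ι] [Nonempty ι] {N : ℕ}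
    {s A K : ℝ} (hs : 0 < s) (hN : N ≠ 0) (hK : 0 ≤ K) (hKA : K ≤ A) (m : ι → ℤ)
    (hm : ∀ j, |(m j : ℝ)| ^ N * K ≤ A) :
    K ^ s ≤ A ^ s * (‖m‖ ^ (-(N * s)) + (Pi.single 0 1 : (ι → ℤ) → ℝ) m) := by
  have hA : 0 ≤ A := hK.trans hKA
  by_cases h0 : m = 0
  · subst h0
    have : -((N : ℝ) * s) ≠ 0 := by
      have : (N : ℝ) ≠ 0 := by exact_mod_cast hN
      have := mul_ne_zero this hs.ne'
      simpa using this
    rw [norm_zero, Real.zero_rpow this, Pi.single_eq_same, zero_add, mul_one]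
    exact Real.rpow_le_rpow hK hKA hs.le
  · obtain ⟨j, hj⟩ := Finite.exists_max fun j => ‖m j‖
    have hmj : ‖m‖ = ‖m j‖ :=
      le_antisymm ((pi_norm_le_iff_of_nonneg (norm_nonneg _)).2 hj) (norm_le_pi_norm m j)
    have hpos : 0 < ‖m‖ := norm_pos_iff.2 h0
    have hle : K ≤ A * (‖m‖ ^ N)⁻¹ := by
      rw [← div_eq_mul_inv, le_div_iff₀ (by positivity), mul_comm, hmj, Int.norm_eq_abs]
      exact hm j
    rw [Pi.single_eq_of_ne h0, add_zero, Real.rpow_neg hpos.le, Real.rpow_mul hpos.le,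
      Real.rpow_natCast, ← Real.inv_rpow (by positivity), ← Real.mul_rpow hA (by positivity)]
    exact Real.rpow_le_rpow hK hle hs.le

/-- The distance of `E` to `[∑ inf h_j, ∑ sup h_j]` bounds `|∑ h_j(θ_j) − E|` from below. -/
theorem max_sub_le_abs_sum_sub {ι : Type*} [Fintype ι] {h : ι → ℝ → ℝ}
    (hbelow : ∀ j, BddBelow (Set.range (h j))) (habove : ∀ j, BddAbove (Set.range (h j)))
    (E : ℝ) (θ : ι → ℝ) :
    max (E - ∑ j, ⨆ x, h j x) ((∑ j, ⨅ x, h j x) - E) ≤ |(∑ j, h j (θ j)) - E| := by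
  have h1 : ∑ j, h j (θ j) ≤ ∑ j, ⨆ x, h j x :=
    Finset.sum_le_sum fun j _ => le_ciSup (habove j) (θ j)
  have h2 : ∑ j, ⨅ x, h j x ≤ ∑ j, h j (θ j) :=
    Finset.sum_le_sum fun j _ => ciInf_le (hbelow j) (θ j)
  refine max_le ?_ ?_
  · exact le_trans (by linarith) (neg_le_abs _)
  · exact le_trans (by linarith) (le_abs_self _)

theorem tendsto_inv_mul_max_one_inv_pow_atTop (N : ℕ) :
    Tendsto (fun d : ℝ => d⁻¹ * max 1 d⁻¹ ^ N) atTop (nhds 0) := by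
  have h1 : Tendsto (fun d : ℝ => d⁻¹) atTop (nhds 0) := tendsto_inv_atTop_zero
  have h2 : Tendsto (fun d : ℝ => d⁻¹ * max 1 d⁻¹ ^ N) atTop (nhds (0 * max 1 0 ^ N)) :=
    h1.mul ((tendsto_const_nhds.max h1).pow N)
  simpa using h2

/-- For `ν/(3ν+3) < s ≤ 1` and `E ∉ [E₋, E₊]`, the fractional moment sum
`S(E) = ∑_m |⟨δ_0, (H₀−E)^{−1} δ_m⟩|^s` is finite, and `S(E) → 0` as `E → ±∞`. -/
theorem resolvent_kernel_fractional_moment_sum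
    (ν : ℕ) (hν : 1 ≤ ν)
    (h : Fin ν → ℝ → ℝ)
    (hper : ∀ j, Function.Periodic (h j) (2 * π))
    (hsmooth : ∀ j, ContDiff ℝ (3 * ν + 3 : ℕ) (h j))
    (s : ℝ) (hs₁ : (ν : ℝ) / (3 * ν + 3) < s) (hs₂ : s ≤ 1) :
    (∀ E : ℝ, E ∉ Set.Icc (∑ j, ⨅ θ : ℝ, h j θ) (∑ j, ⨆ θ : ℝ, h j θ) →
      Summable fun m : Fin ν → ℤ => ‖resolventKernel ν h E m‖ ^ s) ∧
    Tendsto (fun E : ℝ => ∑' m : Fin ν → ℤ, ‖resolventKernel ν h E m‖ ^ s)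
      atTop (nhds 0) ∧
    Tendsto (fun E : ℝ => ∑' m : Fin ν → ℤ, ‖resolventKernel ν h E m‖ ^ s)
      atBot (nhds 0) := by
  have hν0 : (1 : ℝ) ≤ ν := by exact_mod_cast hν
  have hs : 0 < s := lt_of_le_of_lt (by positivity) hs₁
  have : Nonempty (Fin ν) := ⟨⟨0, hν⟩⟩
  set N := 3 * ν + 3 with hN
  have hbdd : ∀ j, Bornology.IsBounded (Set.range (h j)) := fun j =>
    (hper j).isBounded_of_continuous Real.two_pi_pos.ne' (hsmooth j).continuous
  choose D hD1 hD using fun j =>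
    exists_abs_iteratedDeriv_le_pow Real.two_pi_pos.ne' (hsmooth j) (hper j)
  set P : ℝ := N.factorial * N.factorial * (1 + ∑ j, D j ^ N) with hP
  have hfac : (1 : ℝ) ≤ N.factorial := by exact_mod_cast N.factorial_pos
  have hDN : ∀ j, 0 ≤ D j ^ N := fun j => zero_le_one.trans (one_le_pow₀ (hD1 j))
  have hDP : ∀ j, D j ^ N ≤ 1 + ∑ j, D j ^ N := fun j =>
    (Finset.single_le_sum (fun j _ => hDN j) (Finset.mem_univ j)).trans
      (le_add_of_nonneg_left zero_le_one)
  have hP1 : 1 ≤ P := by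
    have : 1 ≤ 1 + ∑ j, D j ^ N := le_add_of_nonneg_right (Finset.sum_nonneg fun j _ => hDN j)
    exact one_le_mul_of_one_le_of_one_le (one_le_mul_of_one_le_of_one_le hfac hfac) this
  set W : (Fin ν → ℤ) → ℝ := fun m => ‖m‖ ^ (-((N : ℝ) * s)) + (Pi.single 0 1 : (Fin ν → ℤ) → ℝ) m with hW
  have hWsum : Summable W := by
    refine (summable_norm_int_rpow ?_).add (summable_of_hasFiniteSupport ?_)
    · have : (ν : ℝ) < s * (3 * ν + 3) := (div_lt_iff₀ (by positivity)).1 hs₁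
      rw [hN, Fintype.card_fin]
      push_cast
      linarith
    · exact (Set.finite_singleton 0).subset Pi.support_single_subset
  have main : ∀ d E : ℝ, 0 < d → (∀ θ : Fin ν → ℝ, d ≤ |(∑ j, h j (θ j)) - E|) → ∀ m,
      ‖resolventKernel ν h E m‖ ^ s ≤ (P * (d⁻¹ * max 1 d⁻¹ ^ N)) ^ s * W m := by
    intro d E hd hlow m
    have hdinv : 0 < d⁻¹ := inv_pos.2 hd
    have hmax : 1 ≤ max 1 d⁻¹ ^ N := one_le_pow₀ (le_max_left _ _)
    have hq : d⁻¹ ≤ d⁻¹ * max 1 d⁻¹ ^ N := le_mul_of_one_le_right hdinv.le hmax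
    refine norm_rpow_le_mul_of_norm_pow_mul_le hs (by omega) (norm_nonneg _) ?_ m fun j => ?_
    · exact (norm_resolventKernel_le hd hlow m).trans
        (hq.trans (le_mul_of_one_le_left (hdinv.le.trans hq) hP1))
    · refine (abs_pow_mul_norm_resolventKernel_le hper hsmooth hd hlow j (hD j) m).trans ?_
      calc _ = (N.factorial * N.factorial * D j ^ N) * (d⁻¹ * max 1 d⁻¹ ^ N) := by ring
        _ ≤ _ := by
          rw [hP]
          gcongr
          exact hDP j
  have hdist := max_sub_le_abs_sum_sub (fun j => (hbdd j).bddBelow) (fun j => (hbdd j).bddAbove)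
  have hlim : ∀ {l : Filter ℝ} {d : ℝ → ℝ}, Tendsto d l atTop →
      (∀ E (θ : Fin ν → ℝ), d E ≤ |(∑ j, h j (θ j)) - E|) →
      Tendsto (fun E => ∑' m : Fin ν → ℤ, ‖resolventKernel ν h E m‖ ^ s) l (nhds 0) := by
    intro l d hd hlow
    have hup : Tendsto (fun E => (P * ((d E)⁻¹ * max 1 (d E)⁻¹ ^ N)) ^ s * ∑' m, W m) l
        (nhds 0) := by
      have := ((((tendsto_inv_mul_max_one_inv_pow_atTop N).comp hd).const_mul P).rpow_const
        (p := s) (Or.inr hs.le)).mul_const (∑' m, W m)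
      simpa [Real.zero_rpow hs.ne'] using this
    refine tendsto_of_tendsto_of_tendsto_of_le_of_le' tendsto_const_nhds hup
      (Eventually.of_forall fun E => tsum_nonneg fun m => by positivity) ?_
    filter_upwards [hd.eventually_gt_atTop 0] with E hE
    have hbound := main (d E) E hE (hlow E)
    rw [← tsum_mul_left]
    exact (Summable.of_nonneg_of_le (fun m => by positivity) hbound
      (hWsum.mul_left _)).tsum_le_tsum hbound (hWsum.mul_left _)
  refine ⟨fun E hE => ?_, hlim ?_ fun E θ => (le_max_left _ _).trans (hdist E θ),
    hlim ?_ fun E θ => (le_max_right _ _).trans (hdist E θ)⟩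
  · have hpos : 0 < max (E - ∑ j, ⨆ x, h j x) ((∑ j, ⨅ x, h j x) - E) := by
      rw [lt_max_iff]
      by_contra! hcon
      exact hE ⟨by linarith [hcon.2], by linarith [hcon.1]⟩
    exact Summable.of_nonneg_of_le (fun m => by positivity) (main _ E hpos (hdist E))
      (hWsum.mul_left _)
  · exact tendsto_atTop_add_const_right _ _ tendsto_id
  · exact tendsto_atTop_add_const_left _ _ tendsto_neg_atBot_atTop
end
end
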